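/- arXiv:math/0610363 — 11 statements merged into one kernel-verified Lean document; each statement's English description precedes it below -/
import Mathlib

section
/- Let U ⊆ ℝⁿ be open and u : U → ℝ. Suppose that for every point x̄ ∈ U there exist an open neighborhood V ⊆ U of x̄ and a real number σ > 0 such that for every x ∈ V there exists p_x ∈ ℝⁿ with u(y) ≤ u(x) + ⟨p_x, y − x⟩ + σ·|y − x|² for every y ∈ V. Then u is locally semiconcave on U, i.e., every point of U has an open convex neighborhood on which u is C-semiconcave for some C ≥ 0. -/
open scoped RealInnerProductSpace ENNReal Gradient
open Set Filter

noncomputable section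

abbrev E (n : ℕ) := EuclideanSpace ℝ (Fin n)

/-- `u` is `C`-semiconcave on the convex set `A`. -/
def IsSemiconcaveOn {n : ℕ} (C : ℝ) (A : Set (E n)) (u : E n → ℝ) : Prop :=
  ∀ x ∈ A, ∀ y ∈ A, ∀ μ : ℝ, μ ∈ Icc (0:ℝ) 1 →
    μ * u x + (1 - μ) * u y - u (μ • x + (1 - μ) • y) ≤ μ * (1 - μ) * C * ‖x - y‖ ^ 2

/-- `u` is locally semiconcave on the open set `U`: every point has an open convex
neighborhood contained in `U` on which `u` is `C`-semiconcave for some `C ≥ 0`. -/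
def LocallySemiconcaveOn {n : ℕ} (U : Set (E n)) (u : E n → ℝ) : Prop :=
  ∀ x ∈ U, ∃ V : Set (E n), IsOpen V ∧ Convex ℝ V ∧ x ∈ V ∧ V ⊆ U ∧
    ∃ C : ℝ, 0 ≤ C ∧ IsSemiconcaveOn C V u

/-- The Fréchet superdifferential `D⁺u(x)`:
`p ∈ D⁺u(x)` iff `limsup_{y → x} (u y - u x - ⟪p, y - x⟫)/‖y - x‖ ≤ 0`. -/
def superdiff {n : ℕ} (u : E n → ℝ) (x : E n) : Set (E n) :=
  {p | ∀ ε > (0:ℝ), ∀ᶠ y in nhds x, u y - u x - ⟪p, y - x⟫ ≤ ε * ‖y - x‖}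

/-- The Fréchet subdifferential `D⁻u(x)`. -/
def subdiff {n : ℕ} (u : E n → ℝ) (x : E n) : Set (E n) :=
  {p | ∀ ε > (0:ℝ), ∀ᶠ y in nhds x, -(ε * ‖y - x‖) ≤ u y - u x - ⟪p, y - x⟫}

/-- if around every point of the open set `U` there is a neighborhood `V ⊆ U`
and `σ > 0` such that every `x ∈ V` admits `p_x` with
`u y ≤ u x + ⟪p_x, y - x⟫ + σ‖y - x‖²` on `V`, then `u` is locally semiconcave on `U`. -/
theorem stmt_0 {n : ℕ} (U : Set (E n)) (hU : IsOpen U) (u : E n → ℝ)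
    (h : ∀ x ∈ U, ∃ V : Set (E n), IsOpen V ∧ x ∈ V ∧ V ⊆ U ∧ ∃ σ : ℝ, 0 < σ ∧
      ∀ x' ∈ V, ∃ p : E n, ∀ y ∈ V, u y ≤ u x' + ⟪p, y - x'⟫ + σ * ‖y - x'‖ ^ 2) :
    LocallySemiconcaveOn U u := by
  intro x hx
  obtain ⟨V, hVo, hxV, hVU, σ, hσ, hp⟩ := h x hx
  obtain ⟨r, hr, hb⟩ := Metric.isOpen_iff.1 hVo x hxV
  refine ⟨Metric.ball x r, Metric.isOpen_ball, convex_ball x r, Metric.mem_ball_self hr,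
    hb.trans hVU, σ, hσ.le, ?_⟩
  intro a ha b hb' μ hμ
  obtain ⟨h0, h1⟩ := hμ
  have hz : μ • a + (1 - μ) • b ∈ Metric.ball x r :=
    convex_ball x r ha hb' h0 (sub_nonneg.2 h1) (by ring)
  obtain ⟨p, hpz⟩ := hp _ (hb hz)
  have ea : a - (μ • a + (1 - μ) • b) = (1 - μ) • (a - b) := by module
  have eb : b - (μ • a + (1 - μ) • b) = (-μ) • (a - b) := by module
  have ha' := hpz a (hb ha)
  have hb2 := hpz b (hb hb')
  rw [ea, inner_smul_right, norm_smul, mul_pow, Real.norm_eq_abs, sq_abs] at ha'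
  rw [eb, inner_smul_right, norm_smul, mul_pow, Real.norm_eq_abs, sq_abs] at hb2
  have k1 := mul_le_mul_of_nonneg_left ha' h0
  have k2 := mul_le_mul_of_nonneg_left hb2 (sub_nonneg.2 h1)
  linarith
end
end

section
/- Let U ⊆ ℝⁿ be an open convex set and let u : U → ℝ be C-semiconcave on U for some C ≥ 0. Then for every x ∈ U, the Fréchet superdifferential D⁺u(x) equals the convex hull of the reachable gradient set { p ∈ ℝⁿ : there exists a sequence x_k → x with x_k ∈ U, u differentiable at each x_k, and ∇u(x_k) → p }. -/
open scoped RealInnerProductSpace ENNReal Gradient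
open Set Filter

noncomputable section

/-- The reachable gradient set of `u` at `x`: limits of gradients of `u` along sequences of
points of `U` of differentiability of `u` converging to `x`. -/
def reachableGradients {n : ℕ} (U : Set (E n)) (u : E n → ℝ) (x : E n) : Set (E n) :=
  {p | ∃ xk : ℕ → E n, (∀ k, xk k ∈ U) ∧ (∀ k, DifferentiableAt ℝ u (xk k)) ∧
    Tendsto xk atTop (nhds x) ∧ Tendsto (fun k => ∇ u (xk k)) atTop (nhds p)}


theorem aux_compact_hull {n : ℕ} (K : Set (E n)) (hK : IsCompact K) :
    IsCompact (convexHull ℝ K) := by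
  rcases K.eq_empty_or_nonempty with rfl | ⟨z0, hz0⟩
  · simp
  have h1 : IsCompact ((stdSimplex ℝ (Fin (n+1))) ×ˢ (Set.univ.pi fun _ : Fin (n+1) => K)) :=
    (isCompact_stdSimplex ℝ _).prod (isCompact_univ_pi fun _ => hK)
  have h2 : Continuous (fun a : (Fin (n+1) → ℝ) × (Fin (n+1) → E n) => ∑ i, a.1 i • a.2 i) := by
    fun_prop
  have h3 := h1.image h2
  convert h3 using 1
  apply Subset.antisymm
  · intro p hp
    obtain ⟨ι, hι, z, w, hz, hind, hw, hw1, hsum⟩ := eq_pos_convex_span_of_mem_convexHull hp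
    have hcard : Fintype.card ι ≤ Fintype.card (Fin (n+1)) := by
      have := hind.card_le_finrank_succ
      have h4 := Submodule.finrank_le (vectorSpan ℝ (Set.range z))
      simp at h4 ⊢
      omega
    obtain ⟨e⟩ := Function.Embedding.nonempty_of_card_le hcard
    refine ⟨(Function.extend e w 0, Function.extend e z (fun _ => z0)), ⟨⟨?_, ?_⟩, ?_⟩, ?_⟩
    · intro j
      by_cases hj : ∃ i, e i = j
      · obtain ⟨i, rfl⟩ := hj
        simp [e.injective.extend_apply, (hw i).le]
      · simp [Function.extend_apply' _ _ _ hj]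
    · rw [← hw1]
      symm
      apply Fintype.sum_of_injective e e.injective
      · intro j hj
        exact Function.extend_apply' _ _ _ hj
      · intro i
        simp [e.injective.extend_apply]
    · intro j _
      by_cases hj : ∃ i, e i = j
      · obtain ⟨i, rfl⟩ := hj
        simp only [e.injective.extend_apply]
        exact hz ⟨i, rfl⟩
      · simpa [Function.extend_apply' _ _ _ hj] using hz0
    · rw [← hsum]
      symm
      apply Fintype.sum_of_injective e e.injective
      · intro j hj
        simp [Function.extend_apply' _ _ _ hj]
      · intro i
        simp [e.injective.extend_apply]
  · rintro _ ⟨⟨w, z⟩, ⟨⟨hw, hw1⟩, hz⟩, rfl⟩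
    exact (convex_convexHull ℝ K).sum_mem (fun i _ => hw i) hw1
      (fun i _ => subset_convexHull ℝ K (hz i (mem_univ i)))

theorem aux_lip {n : ℕ} (U : Set (E n)) (hU : IsOpen U) (hUc : Convex ℝ U)
    (C : ℝ) (u : E n → ℝ) (hu : IsSemiconcaveOn C U u) (x : E n) (hx : x ∈ U) :
    ∃ K : NNReal, ∃ r > 0, Metric.ball x r ⊆ U ∧ LipschitzOnWith K u (Metric.ball x r) := by
  have hconc : ConcaveOn ℝ U (fun y => u y - C * ‖y‖ ^ 2) := by
    refine ⟨hUc, ?_⟩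
    intro y hy z hz a b ha hb hab
    have hb' : b = 1 - a := by linarith
    subst hb'
    have h := hu y hy z hz a ⟨ha, by linarith⟩
    have e1 : ‖a • y + (1 - a) • z‖ ^ 2
        = a ^ 2 * ‖y‖ ^ 2 + 2 * (a * (1 - a) * ⟪y, z⟫) + (1 - a) ^ 2 * ‖z‖ ^ 2 := by
      rw [norm_add_sq_real, norm_smul, norm_smul, real_inner_smul_left, real_inner_smul_right,
        mul_pow, mul_pow, Real.norm_eq_abs, Real.norm_eq_abs, sq_abs, sq_abs]
      ring
    have e2 := norm_sub_sq_real y z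
    simp only [smul_eq_mul]
    rw [e1]
    rw [e2] at h
    nlinarith
  obtain ⟨K1, t1, ht1, hl1⟩ := hconc.locallyLipschitzOn hU hx
  rw [hU.nhdsWithin_eq hx] at ht1
  have hcd : ContDiffAt ℝ 1 (fun y : E n => C * ‖y‖ ^ 2) x :=
    contDiffAt_const.mul (contDiff_norm_sq ℝ).contDiffAt
  obtain ⟨K2, t2, ht2, hl2⟩ := hcd.exists_lipschitzOnWith
  obtain ⟨r, hr, hsub⟩ := Metric.mem_nhds_iff.1
    (inter_mem (inter_mem ht1 ht2) (hU.mem_nhds hx))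
  refine ⟨K1 + K2, r, hr, fun y hy => (hsub hy).2, ?_⟩
  have := (hl1.mono (fun y hy => (hsub hy).1.1)).add (hl2.mono (fun y hy => (hsub hy).1.2))
  simpa using this

theorem aux_super {n : ℕ} (U : Set (E n)) (hU : IsOpen U)
    (C : ℝ) (hC : 0 ≤ C) (u : E n → ℝ) (hu : IsSemiconcaveOn C U u) (x : E n) (hx : x ∈ U)
    (p : E n) :
    p ∈ superdiff u x ↔ ∀ z ∈ U, u z ≤ u x + ⟪p, z - x⟫ + C * ‖z - x‖ ^ 2 := by
  constructor
  · intro hp z hz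
    have key : ∀ ε > (0:ℝ), u z ≤ u x + ⟪p, z - x⟫ + C * ‖z - x‖ ^ 2 + ε * ‖z - x‖ := by
      intro ε hε
      have h1 := hp ε hε
      have ht : Tendsto (fun μ : ℝ => x + μ • (z - x)) (nhdsWithin 0 (Ioi 0)) (nhds x) := by
        have : Continuous (fun μ : ℝ => x + μ • (z - x)) := by fun_prop
        have h := this.tendsto 0
        simp only [zero_smul, add_zero] at h
        exact h.mono_left nhdsWithin_le_nhds
      have h2 := ht.eventually h1
      have h3 : ∀ᶠ μ : ℝ in nhdsWithin 0 (Ioi 0), μ ∈ Ioo (0:ℝ) 1 :=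
        Ioo_mem_nhdsGT one_pos
      obtain ⟨μ, h4, h5, h6⟩ := (h2.and h3).exists
      have h7 := hu z hz x hx μ ⟨h5.le, h6.le⟩
      have e : μ • z + (1 - μ) • x = x + μ • (z - x) := by
        module
      rw [e] at h7
      simp only [add_sub_cancel_left, real_inner_smul_right, norm_smul, Real.norm_eq_abs,
        abs_of_pos h5] at h4
      have h8 : 0 ≤ μ * (μ * (C * ‖z - x‖ ^ 2)) := by positivity
      have h9 : μ * u z ≤ μ * (u x + ⟪p, z - x⟫ + C * ‖z - x‖ ^ 2 + ε * ‖z - x‖) := by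
        nlinarith
      exact le_of_mul_le_mul_left h9 h5
    apply le_of_forall_pos_le_add
    intro δ hδ
    have h := key (δ / (‖z - x‖ + 1)) (by positivity)
    have : δ / (‖z - x‖ + 1) * ‖z - x‖ ≤ δ := by
      rw [div_mul_eq_mul_div, div_le_iff₀ (by positivity)]
      nlinarith
    linarith
  · intro h ε hε
    have hball : ∀ᶠ y in nhds x, y ∈ Metric.ball x (ε / (C + 1)) :=
      Metric.ball_mem_nhds x (by positivity)
    filter_upwards [hU.mem_nhds hx, hball] with y hy hyb
    have h1 := h y hy
    rw [Metric.mem_ball, dist_eq_norm, lt_div_iff₀ (by positivity)] at hyb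
    have h2 : C * ‖y - x‖ ≤ ε := by nlinarith [norm_nonneg (y - x)]
    nlinarith [norm_nonneg (y - x)]

theorem aux_grad {n : ℕ} (u : E n → ℝ) (y : E n) (h : DifferentiableAt ℝ u y) :
    ∇ u y ∈ superdiff u y := by
  intro ε hε
  have := (hasGradientAt_iff_isLittleO.1 h.hasGradientAt).def hε
  filter_upwards [this] with z hz
  exact (le_abs_self _).trans hz

theorem aux_dense {n : ℕ} (u : E n → ℝ) (x : E n) (r : ℝ) (K : NNReal)
    (hl : LipschitzOnWith K u (Metric.ball x r)) :
    Metric.ball x r ⊆ closure {y | y ∈ Metric.ball x r ∧ DifferentiableAt ℝ u y} := by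
  have h := hl.ae_differentiableWithinAt_of_mem (μ := MeasureTheory.volume)
  have hd := MeasureTheory.Measure.dense_of_ae h
  intro y hy
  have h1 := hd.open_subset_closure_inter Metric.isOpen_ball hy
  refine closure_mono ?_ h1
  rintro z ⟨hz, hz'⟩
  exact ⟨hz, (hz' hz).differentiableAt (Metric.isOpen_ball.mem_nhds hz)⟩

theorem aux_gradbound {n : ℕ} (u : E n → ℝ) (x : E n) (r : ℝ) (K : NNReal)
    (hl : LipschitzOnWith K u (Metric.ball x r)) (y : E n) (hy : y ∈ Metric.ball x r) :
    ‖∇ u y‖ ≤ K := by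
  have := norm_fderiv_le_of_lipschitzOn ℝ (Metric.isOpen_ball.mem_nhds hy) hl
  simpa [gradient] using this

theorem aux_R_compact {n : ℕ} (U : Set (E n)) (u : E n → ℝ) (x : E n) (r : ℝ) (hr : 0 < r)
    (K : NNReal) (hl : LipschitzOnWith K u (Metric.ball x r)) :
    IsCompact (reachableGradients U u x) := by
  have hR : reachableGradients U u x = (fun q : E n => (x, q)) ⁻¹'
      closure ((fun y => (y, ∇ u y)) '' {y | y ∈ U ∧ DifferentiableAt ℝ u y}) := by
    ext q
    rw [mem_preimage, mem_closure_iff_seq_limit]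
    constructor
    · rintro ⟨xk, h1, h2, h3, h4⟩
      exact ⟨fun k => (xk k, ∇ u (xk k)), fun k => ⟨xk k, ⟨h1 k, h2 k⟩, rfl⟩,
        h3.prodMk_nhds h4⟩
    · rintro ⟨s, h1, h2⟩
      choose xk hxk hs using h1
      have hs' : s = fun k => (xk k, ∇ u (xk k)) := funext fun k => (hs k).symm
      rw [hs', nhds_prod_eq, tendsto_prod_iff'] at h2
      exact ⟨xk, fun k => (hxk k).1, fun k => (hxk k).2, h2.1, h2.2⟩
  have hcl : IsClosed (reachableGradients U u x) := by
    rw [hR]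
    exact isClosed_closure.preimage (by fun_prop)
  refine (isCompact_closedBall (0 : E n) K).of_isClosed_subset hcl ?_
  rintro q ⟨xk, h1, h2, h3, h4⟩
  refine Metric.isClosed_closedBall.mem_of_tendsto h4 ?_
  filter_upwards [h3.eventually (Metric.ball_mem_nhds x hr)] with k hk
  rw [mem_closedBall_zero_iff]
  exact aux_gradbound u x r K hl _ hk

/-- if `u` is `C`-semiconcave on the open convex set `U`, then at every point the
Fréchet superdifferential equals the convex hull of the reachable gradient set. -/
theorem stmt_3 {n : ℕ} (U : Set (E n)) (hU : IsOpen U) (hUc : Convex ℝ U)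
    (C : ℝ) (hC : 0 ≤ C) (u : E n → ℝ) (hu : IsSemiconcaveOn C U u) :
    ∀ x ∈ U, superdiff u x = convexHull ℝ (reachableGradients U u x) := by
  intro x hx
  obtain ⟨K, r, hr, hrU, hl⟩ := aux_lip U hU hUc C u hu x hx
  have hcx : ContinuousAt u x := hl.continuousOn.continuousAt (Metric.ball_mem_nhds x hr)
  apply Subset.antisymm
  · intro p hp
    by_contra hnot
    obtain ⟨f, s, hfp, hfR⟩ := geometric_hahn_banach_point_closed (convex_convexHull ℝ _)
      (aux_compact_hull _ (aux_R_compact U u x r hr K hl)).isClosed hnot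
    set θ := (InnerProductSpace.toDual ℝ (E n)).symm f with hθ
    have hf : ∀ q, f q = ⟪q, θ⟫ := by
      intro q
      rw [real_inner_comm, hθ, InnerProductSpace.toDual_symm_apply]
    obtain ⟨δ, hδ, hδr⟩ : ∃ δ > 0, δ * ‖θ‖ < r := by
      refine ⟨r / (‖θ‖ + 1), by positivity, ?_⟩
      rw [div_mul_eq_mul_div, div_lt_iff₀ (by positivity)]
      nlinarith
    set t : ℕ → ℝ := fun k => δ * (1 / ((k:ℝ) + 1)) with ht
    have htpos : ∀ k, 0 < t k := fun k => by simp only [ht]; positivity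
    have ht0 : Tendsto t atTop (nhds 0) := by
      have := (tendsto_one_div_add_atTop_nhds_zero_nat (𝕜 := ℝ)).const_mul δ
      simpa [ht] using this
    have hex : ∀ k, ∃ y, (y ∈ Metric.ball x r ∧ DifferentiableAt ℝ u y) ∧
        ‖y - (x + t k • θ)‖ < t k ^ 2 := by
      intro k
      have hle : t k ≤ δ := by
        have : 1 / ((k:ℝ) + 1) ≤ 1 := by
          rw [div_le_one (by positivity)]
          linarith [Nat.cast_nonneg (α := ℝ) k]
        simp only [ht]
        nlinarith
      have hm : x + t k • θ ∈ Metric.ball x r := by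
        rw [Metric.mem_ball, dist_eq_norm, add_sub_cancel_left, norm_smul, Real.norm_eq_abs,
          abs_of_pos (htpos k)]
        nlinarith [norm_nonneg θ]
      obtain ⟨y, hy, hd⟩ := Metric.mem_closure_iff.1 (aux_dense u x r K hl hm) (t k ^ 2)
        (pow_pos (htpos k) 2)
      refine ⟨y, hy, ?_⟩
      rwa [dist_comm, dist_eq_norm] at hd
    choose y hy hyd using hex
    set w : ℕ → E n := fun k => (t k)⁻¹ • (y k - x) with hw
    have hyw : ∀ k, y k - x = t k • w k := by
      intro k
      simp only [hw]
      rw [smul_inv_smul₀ (htpos k).ne']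
    have hwθ : Tendsto w atTop (nhds θ) := by
      rw [tendsto_iff_norm_sub_tendsto_zero]
      refine squeeze_zero (fun k => norm_nonneg _) (fun k => ?_) ht0
      have h1 := hyd k
      have e : y k - (x + t k • θ) = t k • (w k - θ) := by
        rw [smul_sub, ← hyw]; abel
      rw [e, norm_smul, Real.norm_eq_abs, abs_of_pos (htpos k), sq] at h1
      exact (lt_of_mul_lt_mul_left h1 (htpos k).le).le
    have hyx : Tendsto y atTop (nhds x) := by
      have h1 := (ht0.smul hwθ).const_add x
      simp only [zero_smul, add_zero] at h1
      refine h1.congr fun k => ?_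
      rw [← hyw]; abel
    obtain ⟨q, hq, φ, hφ, hqφ⟩ := (isCompact_closedBall (0 : E n) K).tendsto_subseq
      (x := fun k => ∇ u (y k)) (fun k => by
        rw [mem_closedBall_zero_iff]
        exact aux_gradbound u x r K hl _ (hy k).1)
    have hqR : q ∈ reachableGradients U u x :=
      ⟨y ∘ φ, fun k => hrU (hy _).1, fun k => (hy _).2, hyx.comp hφ.tendsto_atTop, hqφ⟩
    have hineq : ∀ k, ⟪∇ u (y k), w k⟫ ≤ ⟪p, w k⟫ + 2 * C * (t k * ‖w k‖ ^ 2) := by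
      intro k
      have h1 := (aux_super U hU C hC u hu x hx p).1 hp (y k) (hrU (hy k).1)
      have h2 := (aux_super U hU C hC u hu (y k) (hrU (hy k).1) _).1
        (aux_grad u (y k) (hy k).2) x hx
      rw [← neg_sub (y k) x, norm_neg, inner_neg_right] at h2
      rw [hyw, real_inner_smul_right, norm_smul, Real.norm_eq_abs, abs_of_pos (htpos k)] at h1 h2
      have h3 : t k * ⟪∇ u (y k), w k⟫ ≤ t k * (⟪p, w k⟫ + 2 * C * (t k * ‖w k‖ ^ 2)) := by
        nlinarith
      exact le_of_mul_le_mul_left h3 (htpos k)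
    have hlim : ⟪q, θ⟫ ≤ ⟪p, θ⟫ := by
      have hwφ := hwθ.comp hφ.tendsto_atTop
      have htφ := ht0.comp hφ.tendsto_atTop
      have hL := hqφ.inner (𝕜 := ℝ) hwφ
      have hR := ((tendsto_const_nhds (x := p)).inner (𝕜 := ℝ) hwφ).add
        ((htφ.mul (hwφ.norm.pow 2)).const_mul (2 * C))
      have := le_of_tendsto_of_tendsto' hL hR (fun k => hineq (φ k))
      simpa using this
    have := hfR q (subset_convexHull ℝ _ hqR)
    rw [hf] at this hfp
    linarith
  · apply convexHull_min
    · rintro p ⟨xk, h1, h2, h3, h4⟩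
      rw [aux_super U hU C hC u hu x hx]
      intro z hz
      have hin : ∀ k, u z ≤ u (xk k) + ⟪∇ u (xk k), z - xk k⟫ + C * ‖z - xk k‖ ^ 2 := fun k =>
        (aux_super U hU C hC u hu (xk k) (h1 k) _).1 (aux_grad u (xk k) (h2 k)) z hz
      have hzx := h3.const_sub z
      have hlim := ((hcx.tendsto.comp h3).add (h4.inner (𝕜 := ℝ) hzx)).add
        ((hzx.norm.pow 2).const_mul C)
      exact ge_of_tendsto' hlim hin
    · intro p hp q hq a b ha hb hab
      rw [aux_super U hU C hC u hu x hx] at hp hq ⊢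
      intro z hz
      have h1 := mul_le_mul_of_nonneg_left (hp z hz) ha
      have h2 := mul_le_mul_of_nonneg_left (hq z hz) hb
      have hb' : b = 1 - a := by linarith
      subst hb'
      rw [inner_add_left, real_inner_smul_left, real_inner_smul_left]
      nlinarith
end
end

section
/- Let U ⊆ ℝⁿ be open and let u : U → ℝ be locally semiconcave on U. Then for every x ∈ U, u is (Fréchet) differentiable at x if and only if the Fréchet superdifferential D⁺u(x) is a singleton. -/
open scoped RealInnerProductSpace ENNReal Gradient
open Set Filter

noncomputable section

lemma aux_dir {n : ℕ} (W : Set (E n)) (hW : IsOpen W) (f : E n → ℝ) (hf : ConvexOn ℝ W f)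
    (h0 : (0 : E n) ∈ W) (f0 : f 0 = 0) (fnn : ∀ h ∈ W, 0 ≤ f h)
    (huniq : ∀ q : E n →L[ℝ] ℝ, (∀ h ∈ W, q h ≤ f h) → q = 0)
    (ε : ℝ) (hε : 0 < ε) (v : E n) : ∃ t : ℝ, 0 < t ∧ t • v ∈ W ∧ f (t • v) < ε * t := by
  by_contra hcon
  push Not at hcon
  have hcont : ContinuousOn f W := hf.continuousOn hW
  have hsopen : IsOpen {p : E n × ℝ | p.1 ∈ W ∧ f p.1 < p.2} := by
    rw [isOpen_iff_mem_nhds]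
    rintro ⟨a, b⟩ ⟨ha, hb⟩
    have h1 : ContinuousAt (fun p : E n × ℝ => f p.1) (a, b) :=
      ContinuousAt.comp (f := fun p : E n × ℝ => p.1) (g := f)
        (hcont.continuousAt (hW.mem_nhds ha)) continuousAt_fst
    have h2 := h1.eventually_lt (continuousAt_snd (p := (a, b))) hb
    have h3 : ∀ᶠ p : E n × ℝ in nhds (a, b), p.1 ∈ W :=
      continuousAt_fst.eventually (hW.mem_nhds ha)
    filter_upwards [h2, h3] with p hp hp' using ⟨hp', hp⟩
  obtain ⟨F, c, hF1, hF2⟩ := geometric_hahn_banach_open (hf.convex_strict_epigraph) hsopen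
    (t := (Submodule.span ℝ {((v, ε) : E n × ℝ)} : Set (E n × ℝ)))
    (Submodule.convex _) (by
      rw [Set.disjoint_left]
      rintro p ⟨hp1, hp2⟩ hp
      obtain ⟨t, rfl⟩ := Submodule.mem_span_singleton.1 hp
      simp only [Prod.smul_fst, Prod.smul_snd, smul_eq_mul] at hp1 hp2
      rcases lt_or_ge 0 t with ht | ht
      · have := hcon t ht hp1
        linarith
      · have := fnn _ hp1
        nlinarith)
  have hline : ∀ t : ℝ, c ≤ t * F (v, ε) := by
    intro t
    have := hF2 (t • (v, ε)) (Submodule.smul_mem _ _ (Submodule.mem_span_singleton_self _))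
    rwa [map_smul, smul_eq_mul] at this
  have hc0 : c ≤ 0 := by simpa using hline 0
  have hFv : F (v, ε) = 0 := by
    by_contra hne
    have := hline ((c - 1) / F (v, ε))
    rw [div_mul_cancel₀ _ hne] at this
    linarith
  set L : E n →L[ℝ] ℝ := F.comp (ContinuousLinearMap.inl ℝ (E n) ℝ) with hL
  set b : ℝ := F (0, 1) with hb
  have hdec : ∀ h y, F (h, y) = L h + y * b := by
    intro h y
    have : ((h, y) : E n × ℝ) = (h, 0) + y • (0, 1) := by simp
    rw [this, map_add, map_smul]; simp [hL, hb]
  have hb0 : b < 0 := lt_of_lt_of_le (hF1 (0, 1) ⟨h0, by simp [f0]⟩) hc0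
  have hq := huniq ((-b)⁻¹ • L) (by
    intro h hh
    apply le_of_forall_gt
    intro y hy
    have := hF1 (h, y) ⟨hh, hy⟩
    rw [hdec] at this
    simp only [ContinuousLinearMap.smul_apply, smul_eq_mul]
    rw [inv_mul_lt_iff₀ (by linarith)]
    linarith)
  have hLv : L v = 0 := by
    have := congrArg (fun q : E n →L[ℝ] ℝ => q v) hq
    simp only [ContinuousLinearMap.smul_apply, smul_eq_mul, ContinuousLinearMap.zero_apply] at this
    rcases mul_eq_zero.1 this with h | h
    · exact absurd h (inv_ne_zero (by linarith))
    · exact h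
  rw [hdec, hLv] at hFv
  nlinarith

lemma aux_scale {n : ℕ} (W : Set (E n)) (f : E n → ℝ) (hf : ConvexOn ℝ W f)
    (h0 : (0 : E n) ∈ W) (f0 : f 0 = 0) (h : E n) (hh : h ∈ W) (s : ℝ) (hs : 0 ≤ s)
    (hs1 : s ≤ 1) : s • h ∈ W ∧ f (s • h) ≤ s * f h := by
  refine ⟨hf.1.smul_mem_of_zero_mem h0 hh ⟨hs, hs1⟩, ?_⟩
  have := hf.2 hh h0 hs (sub_nonneg.2 hs1) (by ring)
  simpa [f0] using this

lemma aux_unif {n : ℕ} (W : Set (E n)) (hW : IsOpen W) (f : E n → ℝ) (hf : ConvexOn ℝ W f)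
    (h0 : (0 : E n) ∈ W) (f0 : f 0 = 0) (fnn : ∀ h ∈ W, 0 ≤ f h)
    (huniq : ∀ q : E n →L[ℝ] ℝ, (∀ h ∈ W, q h ≤ f h) → q = 0)
    (ε : ℝ) (hε : 0 < ε) : ∀ᶠ h in nhds (0 : E n), f h ≤ ε * ‖h‖ := by
  have hcont : ContinuousOn f W := hf.continuousOn hW
  have key : ∃ t : ℝ, 0 < t ∧ ∀ s : ℝ, 0 < s → s ≤ t →
      ∀ w ∈ Metric.closedBall (0 : E n) 1, f (s • w) ≤ ε * s := by
    refine (isCompact_closedBall (0 : E n) 1).induction_on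
      (p := fun S => ∃ t : ℝ, 0 < t ∧ ∀ s : ℝ, 0 < s → s ≤ t → ∀ w ∈ S, f (s • w) ≤ ε * s)
      ⟨1, one_pos, by simp⟩ ?_ ?_ ?_
    · rintro S T hST ⟨t, ht, h⟩
      exact ⟨t, ht, fun s hs hst w hw => h s hs hst w (hST hw)⟩
    · rintro S T ⟨t, ht, h⟩ ⟨t', ht', h'⟩
      refine ⟨min t t', lt_min ht ht', fun s hs hst w hw => ?_⟩
      rcases hw with hw | hw
      · exact h s hs (hst.trans (min_le_left _ _)) w hw
      · exact h' s hs (hst.trans (min_le_right _ _)) w hw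
    · intro v _
      obtain ⟨t, ht, htW, hft⟩ := aux_dir W hW f hf h0 f0 fnn huniq ε hε v
      have hc : ContinuousAt (fun w : E n => t • w) v := by fun_prop
      have h1 : ∀ᶠ w in nhds v, t • w ∈ W := hc.eventually (hW.mem_nhds htW)
      have h2 : ContinuousAt (fun w : E n => f (t • w)) v :=
        ContinuousAt.comp (f := fun w : E n => t • w) (g := f)
          (hcont.continuousAt (hW.mem_nhds htW)) hc
      have h3 := h2.eventually_lt (continuousAt_const (y := ε * t)) hft
      refine ⟨{w | t • w ∈ W ∧ f (t • w) < ε * t}, mem_nhdsWithin_of_mem_nhds (h1.and h3),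
        t, ht, ?_⟩
      rintro s hs hst w ⟨hw1, hw2⟩
      have h4 := (aux_scale W f hf h0 f0 _ hw1 (s / t) (by positivity)
        ((div_le_one ht).2 hst)).2
      rw [smul_smul, div_mul_cancel₀ _ ht.ne'] at h4
      have h5 : s / t * f (t • w) ≤ s / t * (ε * t) :=
        mul_le_mul_of_nonneg_left hw2.le (by positivity)
      have h6 : s / t * (ε * t) = ε * s := by field_simp
      linarith
  obtain ⟨t, ht, h⟩ := key
  filter_upwards [Metric.closedBall_mem_nhds (0 : E n) ht] with k hk
  rcases eq_or_ne k 0 with rfl | hk0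
  · simp [f0]
  · have hkn : 0 < ‖k‖ := norm_pos_iff.2 hk0
    have := h ‖k‖ hkn (by simpa using hk) (‖k‖⁻¹ • k) (by
      simp [norm_smul, inv_mul_cancel₀ hkn.ne'])
    rwa [smul_smul, mul_inv_cancel₀ hkn.ne', one_smul] at this

lemma aux_inner_zero {n : ℕ} (g : E n) (hg : ∀ ε > (0:ℝ), ∀ᶠ h in nhds (0 : E n),
    ⟪g, h⟫ ≤ ε * ‖h‖) : g = 0 := by
  by_contra hne
  have hgn : 0 < ‖g‖ := norm_pos_iff.2 hne
  have h1 := hg (‖g‖ / 2) (by positivity)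
  have hc : Tendsto (fun s : ℝ => s • g) (nhdsWithin 0 (Ioi 0)) (nhds 0) := by
    have : ContinuousAt (fun s : ℝ => s • g) 0 := by fun_prop
    have h := this.tendsto
    simp only [zero_smul] at h
    exact h.mono_left nhdsWithin_le_nhds
  obtain ⟨s, hs, hs0⟩ := ((hc.eventually h1).and self_mem_nhdsWithin).exists
  have hs0 : 0 < s := hs0
  rw [real_inner_smul_right, real_inner_self_eq_norm_sq, norm_smul, Real.norm_of_nonneg hs0.le]
    at hs
  have : 0 < s * ‖g‖ ^ 2 := by positivity
  nlinarith

lemma aux_shift {n : ℕ} (x : E n) (P : E n → Prop) :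
    (∀ᶠ y in nhds x, P y) ↔ ∀ᶠ h in nhds (0 : E n), P (x + h) := by
  rw [← map_add_left_nhds_zero x, eventually_map]

lemma mem_superdiff' {n : ℕ} (u : E n → ℝ) (x p : E n) : p ∈ superdiff u x ↔
    ∀ ε > (0:ℝ), ∀ᶠ h in nhds (0 : E n), u (x + h) - u x - ⟪p, h⟫ ≤ ε * ‖h‖ := by
  simp only [superdiff, mem_setOf_eq]
  refine forall₂_congr fun ε _ => ?_
  rw [aux_shift]
  simp

lemma hasGrad_iff' {n : ℕ} (u : E n → ℝ) (x p : E n) : HasGradientAt u p x ↔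
    ∀ ε > (0:ℝ), ∀ᶠ h in nhds (0 : E n), |u (x + h) - u x - ⟪p, h⟫| ≤ ε * ‖h‖ := by
  rw [hasGradientAt_iff_isLittleO, Asymptotics.isLittleO_iff]
  refine forall₂_congr fun ε _ => ?_
  rw [aux_shift]
  simp

/-- a locally semiconcave function on an open set `U` is differentiable at
`x ∈ U` if and only if its Fréchet superdifferential at `x` is a singleton. -/
theorem stmt_4 {n : ℕ} (U : Set (E n)) (hU : IsOpen U) (u : E n → ℝ)
    (hu : LocallySemiconcaveOn U u) :
    ∀ x ∈ U, DifferentiableAt ℝ u x ↔ ∃ p : E n, superdiff u x = {p} := by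
  intro x hx
  constructor
  · intro hd
    have hg := (hasGrad_iff' u x _).1 hd.hasGradientAt
    refine ⟨∇ u x, ?_⟩
    ext p
    rw [mem_singleton_iff]
    constructor
    · intro hp
      rw [mem_superdiff'] at hp
      symm
      rw [← sub_eq_zero]
      apply aux_inner_zero
      intro ε hε
      filter_upwards [hg (ε / 2) (by positivity), hp (ε / 2) (by positivity)] with h h1 h2
      rw [inner_sub_left]
      have := (abs_le.1 h1).1
      linarith
    · rintro rfl
      rw [mem_superdiff']
      intro ε hε
      filter_upwards [hg ε hε] with h h1 using (abs_le.1 h1).2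
  · rintro ⟨p, hp⟩
    obtain ⟨V, hVo, hVc, hxV, -, C, hC, hsc⟩ := hu x hx
    have hpm : p ∈ superdiff u x := by rw [hp]; rfl
    rw [mem_superdiff'] at hpm
    set f : E n → ℝ := fun h => C * ‖h‖ ^ 2 - (u (x + h) - u x - ⟪p, h⟫) with hfdef
    set W : Set (E n) := (fun h => x + h) ⁻¹' V with hWdef
    have hWo : IsOpen W := hVo.preimage (by fun_prop)
    have h0 : (0 : E n) ∈ W := by simpa [hWdef] using hxV
    have f0 : f 0 = 0 := by simp [hfdef]
    have hconv : ConvexOn ℝ W f := by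
      refine ⟨hVc.translate_preimage_right x, ?_⟩
      intro h hh k hk a b ha hb hab
      obtain rfl : b = 1 - a := by linarith
      have h1 := hsc (x + h) hh (x + k) hk a ⟨ha, by linarith⟩
      have e1 : a • (x + h) + (1 - a) • (x + k) = x + (a • h + (1 - a) • k) := by module
      have e2 : x + h - (x + k) = h - k := by abel
      rw [e1, e2, norm_sub_sq_real] at h1
      simp only [hfdef, smul_eq_mul]
      rw [norm_add_sq_real, norm_smul, norm_smul, inner_add_right, real_inner_smul_right,
        real_inner_smul_right, real_inner_smul_right, real_inner_smul_left,
        Real.norm_of_nonneg ha, Real.norm_of_nonneg hb]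
      linarith
    have fnn : ∀ h ∈ W, 0 ≤ f h := by
      intro h hh
      by_contra! hneg
      have hne : h ≠ 0 := by rintro rfl; linarith
      have hn : 0 < ‖h‖ := norm_pos_iff.2 hne
      have h1 := hpm (- f h / (2 * ‖h‖)) (div_pos (by linarith) (by positivity))
      have hc : Tendsto (fun s : ℝ => s • h) (nhdsWithin 0 (Ioi 0)) (nhds 0) := by
        have : ContinuousAt (fun s : ℝ => s • h) 0 := by fun_prop
        have h := this.tendsto
        simp only [zero_smul] at h
        exact h.mono_left nhdsWithin_le_nhds
      have h2 : ∀ᶠ s : ℝ in nhdsWithin 0 (Ioi 0), s ∈ Ioo (0:ℝ) 1 :=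
        Ioo_mem_nhdsGT one_pos
      obtain ⟨s, hs, hs0, hs1⟩ := ((hc.eventually h1).and h2).exists
      have h3 := (aux_scale W f hconv h0 f0 h hh s hs0.le hs1.le).2
      have h4 : -f h / (2 * ‖h‖) * ‖s • h‖ = s * (-f h) / 2 := by
        rw [norm_smul, Real.norm_of_nonneg hs0.le]; field_simp
      rw [h4] at hs
      have h5 : 0 ≤ C * ‖s • h‖ ^ 2 := by positivity
      have h6 : f (s • h) = C * ‖s • h‖ ^ 2 - (u (x + s • h) - u x - ⟪p, s • h⟫) := rfl
      nlinarith
    have hsq : ∀ ε > (0:ℝ), ∀ᶠ h in nhds (0 : E n), C * ‖h‖ ^ 2 ≤ ε * ‖h‖ := by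
      intro ε hε
      have hc : ContinuousAt (fun h : E n => C * ‖h‖) 0 := by fun_prop
      have := hc.eventually_lt (continuousAt_const (y := ε)) (by simpa using hε)
      filter_upwards [this] with h hh
      nlinarith [norm_nonneg h]
    have huniq : ∀ q : E n →L[ℝ] ℝ, (∀ h ∈ W, q h ≤ f h) → q = 0 := by
      intro q hq
      set g := (InnerProductSpace.toDual ℝ (E n)).symm q with hg
      have hgq : ∀ h, ⟪g, h⟫ = q h := fun h => by
        rw [hg, InnerProductSpace.toDual_symm_apply]
      have hm : p - g ∈ superdiff u x := by
        rw [mem_superdiff']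
        intro ε hε
        filter_upwards [hsq ε hε, hWo.mem_nhds h0] with h h1 h2
        have h3 := hq h h2
        simp only [hfdef] at h3
        rw [inner_sub_left, hgq]
        linarith
      rw [hp, mem_singleton_iff, sub_eq_self] at hm
      ext h
      rw [← hgq, hm]; simp
    have hfin : HasGradientAt u p x := by
      rw [hasGrad_iff']
      intro ε hε
      filter_upwards [hpm ε hε, aux_unif W hWo f hconv h0 f0 fnn huniq ε hε] with h h1 h2
      have h5 : 0 ≤ C * ‖h‖ ^ 2 := by positivity
      simp only [hfdef] at h2
      exact abs_le.2 ⟨by linarith, h1⟩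
    exact hfin.differentiableAt
end
end

section
/- Let U ⊆ ℝⁿ be open and let u : U → ℝ be such that both u and −u are locally semiconcave on U. Then u is of class C^{1,1}_loc on U: u is differentiable at every point of U and the gradient map x ↦ ∇u(x) is locally Lipschitz on U. -/
open scoped RealInnerProductSpace ENNReal Gradient
open Set Filter

noncomputable section

lemma aux_zero (c M δ : ℝ) (hδ : 0 < δ) (h : ∀ t, 0 < t → t < δ → |t * c| ≤ M * t ^ 2) : c = 0 := by
  by_contra hc
  have hc' : 0 < |c| := abs_pos.mpr hc
  have hM : 0 < |M| + 1 := by positivity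
  set t := min (δ / 2) (|c| / (2 * (|M| + 1))) with ht
  have htpos : 0 < t := lt_min (by linarith) (by positivity)
  have h1 := h t htpos (lt_of_le_of_lt (min_le_left _ _) (by linarith))
  have h2 : t * (2 * (|M| + 1)) ≤ |c| := by
    rw [← le_div_iff₀ (by positivity)]
    exact min_le_right _ _
  rw [abs_mul, abs_of_pos htpos] at h1
  have h3 : |c| ≤ M * t := by
    have : t * |c| ≤ t * (M * t) := by linarith
    exact le_of_mul_le_mul_left this htpos
  have h4 : M * t ≤ |M| * t := mul_le_mul_of_nonneg_right (le_abs_self M) htpos.le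
  nlinarith [abs_nonneg M]

lemma aux_dir_s5 {n : ℕ} (u : E n → ℝ) (x : E n) (r K : ℝ) (hr : 0 < r)
    (hK : 0 ≤ K)
    (H : ∀ y ∈ Metric.ball x r, ∀ z ∈ Metric.ball x r, ∀ μ : ℝ, μ ∈ Icc (0:ℝ) 1 →
      |μ * u y + (1 - μ) * u z - u (μ • y + (1 - μ) • z)| ≤ μ * (1 - μ) * K * ‖y - z‖ ^ 2)
    (v : E n) : ∃ d : ℝ, ∀ t : ℝ, 0 < t → t * ‖v‖ < r →
      |u (x + t • v) - u x - t * d| ≤ K * ‖v‖ ^ 2 * t ^ 2 := by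
  set q : ℝ → ℝ := fun t => (u (x + t • v) - u x) / t with hq
  set D := K * ‖v‖ ^ 2 with hD
  have hD0 : 0 ≤ D := by positivity
  have key : ∀ s t, 0 < s → s ≤ t → t * ‖v‖ < r → |q t - q s| ≤ (t - s) * D := by
    intro s t hs hst htr
    have ht : 0 < t := hs.trans_le hst
    have h := H (x + t • v) (by
      simpa [Metric.mem_ball, dist_eq_norm, norm_smul, abs_of_pos ht] using htr) x
      (Metric.mem_ball_self hr) (s / t) ⟨by positivity, by rw [div_le_one ht]; exact hst⟩
    have e1 : (s / t) • (x + t • v) + (1 - s / t) • x = x + s • v := by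
      rw [smul_add, smul_smul, div_mul_cancel₀ _ ht.ne', sub_smul, one_smul]; abel
    rw [e1, add_sub_cancel_left, norm_smul, Real.norm_eq_abs, abs_of_pos ht] at h
    have e2 : s / t * u (x + t • v) + (1 - s / t) * u x - u (x + s • v) = s * (q t - q s) := by
      simp only [hq]; field_simp; ring
    have e3 : s / t * (1 - s / t) * K * (t * ‖v‖) ^ 2 = s * ((t - s) * D) := by
      simp only [hD]; field_simp
    rw [e2, e3, abs_mul, abs_of_pos hs] at h
    exact le_of_mul_le_mul_left h hs
  let T : Set ℝ := {t | 0 < t ∧ t * ‖v‖ < r}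
  have hT : T.Nonempty := by
    refine ⟨r / (‖v‖ + 1), by positivity, ?_⟩
    rw [div_mul_eq_mul_div, div_lt_iff₀ (by positivity)]
    nlinarith
  obtain ⟨d, hd1, hd2⟩ := exists_between_of_forall_le (s := (fun t => q t - t * D) '' T)
    (t := (fun t => q t + t * D) '' T) (hT.image _) (hT.image _) (by
      rintro _ ⟨s, hs, rfl⟩ _ ⟨t, ht, rfl⟩
      simp only
      rcases le_total s t with h | h
      · have := abs_le.1 (key s t hs.1 h ht.2)
        nlinarith [mul_nonneg hs.1.le hD0]
      · have := abs_le.1 (key t s ht.1 h hs.2)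
        nlinarith [mul_nonneg ht.1.le hD0])
  refine ⟨d, fun t ht htr => ?_⟩
  have h1 := hd1 ⟨t, ⟨ht, htr⟩, rfl⟩
  have h2 := hd2 ⟨t, ⟨ht, htr⟩, rfl⟩
  simp only at h1 h2
  have e : u (x + t • v) - u x - t * d = t * (q t - d) := by
    simp only [hq]; field_simp
  rw [e, abs_mul, abs_of_pos ht]
  have : |q t - d| ≤ t * D := abs_le.2 ⟨by linarith, by linarith⟩
  calc t * |q t - d| ≤ t * (t * D) := mul_le_mul_of_nonneg_left this ht.le
    _ = D * t ^ 2 := by ring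

lemma aux_clm {n : ℕ} (u : E n → ℝ) (x : E n) (r K : ℝ) (hr : 0 < r)
    (hK : 0 ≤ K)
    (H : ∀ y ∈ Metric.ball x r, ∀ z ∈ Metric.ball x r, ∀ μ : ℝ, μ ∈ Icc (0:ℝ) 1 →
      |μ * u y + (1 - μ) * u z - u (μ • y + (1 - μ) • z)| ≤ μ * (1 - μ) * K * ‖y - z‖ ^ 2) :
    ∃ L : E n →L[ℝ] ℝ, ∀ v : E n, ‖v‖ < r → |u (x + v) - u x - L v| ≤ K * ‖v‖ ^ 2 := by
  choose d hd using aux_dir_s5 u x r K hr hK H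
  have hadd : ∀ v w, d (v + w) = d v + d w := by
    intro v w
    have : d v + d w - d (v + w) = 0 := by
      refine aux_zero _ (K * ‖v - w‖ ^ 2 + K * ‖v + w‖ ^ 2 + 2 * (K * ‖v‖ ^ 2)
        + 2 * (K * ‖w‖ ^ 2)) (r / (2 * (‖v‖ + ‖w‖ + 1))) (by positivity) ?_
      intro t ht htr
      rw [lt_div_iff₀ (by positivity)] at htr
      have hv := norm_nonneg v
      have hw := norm_nonneg w
      have hvr : (2 * t) * ‖v‖ < r := by nlinarith [mul_nonneg ht.le hw]
      have hwr : (2 * t) * ‖w‖ < r := by nlinarith [mul_nonneg ht.le hv]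
      have hvw : t * ‖v + w‖ < r := by
        nlinarith [mul_nonneg ht.le hv, mul_nonneg ht.le hw, norm_add_le v w,
          mul_le_mul_of_nonneg_left (norm_add_le v w) ht.le]
      have h1 := abs_le.1 (hd v (2 * t) (by positivity) hvr)
      have h2 := abs_le.1 (hd w (2 * t) (by positivity) hwr)
      have h3 := abs_le.1 (hd (v + w) t ht hvw)
      have h4 := H (x + (2 * t) • v) (by
        simpa [Metric.mem_ball, dist_eq_norm, norm_smul, abs_of_pos ht] using hvr)
        (x + (2 * t) • w) (by
        simpa [Metric.mem_ball, dist_eq_norm, norm_smul, abs_of_pos ht] using hwr)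
        (1 / 2) ⟨by norm_num, by norm_num⟩
      have e1 : (1 / 2 : ℝ) • (x + (2 * t) • v) + (1 - 1 / 2 : ℝ) • (x + (2 * t) • w)
          = x + t • (v + w) := by module
      have e2 : (x + (2 * t) • v) - (x + (2 * t) • w) = (2 * t) • (v - w) := by module
      rw [e1, e2, norm_smul, Real.norm_eq_abs, abs_of_pos (show (0:ℝ) < 2 * t by positivity)] at h4
      have h4 := abs_le.1 h4
      rw [abs_le]
      constructor <;> nlinarith
    linarith
  have hpos : ∀ c : ℝ, 0 < c → ∀ v, d (c • v) = c * d v := by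
    intro c hc v
    have : d (c • v) - c * d v = 0 := by
      refine aux_zero _ (K * ‖c • v‖ ^ 2 + K * ‖v‖ ^ 2 * c ^ 2) (r / (c * ‖v‖ + 1))
        (by positivity) ?_
      intro t ht htr
      rw [lt_div_iff₀ (by positivity)] at htr
      have h1 := hd (c • v) t ht (by
        rw [norm_smul, Real.norm_eq_abs, abs_of_pos hc]; linarith)
      have h2 := hd v (t * c) (by positivity) (by linarith)
      rw [smul_smul] at h1
      have h1 := abs_le.1 h1
      have h2 := abs_le.1 h2
      rw [abs_le]
      constructor <;> linarith
    linarith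
  have h0 : d 0 = 0 := by have := hadd 0 0; simp at this; exact this
  have hneg : ∀ v, d (-v) = - d v := by
    intro v
    have := hadd v (-v)
    rw [add_neg_cancel, h0] at this
    linarith
  have hsmul : ∀ (c : ℝ) v, d (c • v) = c * d v := by
    intro c v
    rcases lt_trichotomy c 0 with h | h | h
    · have := hpos (-c) (by linarith) v
      rw [neg_smul, hneg] at this
      linarith
    · simp [h, h0]
    · exact hpos c h v
  let L : E n →ₗ[ℝ] ℝ := { toFun := d, map_add' := hadd, map_smul' := hsmul }
  refine ⟨LinearMap.toContinuousLinearMap L, fun v hv => ?_⟩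
  have := hd v 1 one_pos (by simpa using hv)
  simpa [L] using this

lemma aux_fderiv {n : ℕ} (u : E n → ℝ) (x : E n) (r K : ℝ) (hr : 0 < r)
    (L : E n →L[ℝ] ℝ) (h : ∀ v : E n, ‖v‖ < r → |u (x + v) - u x - L v| ≤ K * ‖v‖ ^ 2) :
    HasFDerivAt u L x := by
  rw [hasFDerivAt_iff_isLittleO_nhds_zero]
  refine Asymptotics.IsBigO.trans_isLittleO (g := fun v : E n => ‖v‖ ^ 2) ?_ ?_
  · refine Asymptotics.IsBigO.of_bound K ?_
    filter_upwards [Metric.ball_mem_nhds (0 : E n) hr] with v hv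
    simpa using h v (by simpa using hv)
  · exact Asymptotics.isLittleO_norm_pow_id one_lt_two

lemma aux_local {n : ℕ} (U : Set (E n)) (u : E n → ℝ)
    (hu : LocallySemiconcaveOn U u) (hu' : LocallySemiconcaveOn U (fun x => -u x))
    (x₀ : E n) (hx₀ : x₀ ∈ U) : ∃ r > 0, ∃ K ≥ 0, ∀ x ∈ Metric.ball x₀ r,
      ∀ v : E n, ‖v‖ < r → |u (x + v) - u x - fderiv ℝ u x v| ≤ K * ‖v‖ ^ 2 ∧
        DifferentiableAt ℝ u x := by
  obtain ⟨V, hVo, -, hxV, -, C, hC, hV⟩ := hu x₀ hx₀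
  obtain ⟨V', hVo', -, hxV', -, C', hC', hV'⟩ := hu' x₀ hx₀
  obtain ⟨R, hR, hRV⟩ := Metric.isOpen_iff.1 (hVo.inter hVo') x₀ ⟨hxV, hxV'⟩
  refine ⟨R / 2, by positivity, C + C', by positivity, fun x hx => ?_⟩
  have hsub : Metric.ball x (R / 2) ⊆ Metric.ball x₀ R := by
    apply Metric.ball_subset_ball'
    have := Metric.mem_ball.1 hx
    linarith
  obtain ⟨L, hL⟩ := aux_clm u x (R / 2) (C + C') (by positivity) (by positivity) (by
    intro y hy z hz μ hμ
    have h1 := hV y (hRV (hsub hy)).1 z (hRV (hsub hz)).1 μ hμ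
    have h2 := hV' y (hRV (hsub hy)).2 z (hRV (hsub hz)).2 μ hμ
    have hm : 0 ≤ μ * (1 - μ) := mul_nonneg hμ.1 (by linarith [hμ.2])
    have a1 : 0 ≤ μ * (1 - μ) * C * ‖y - z‖ ^ 2 := by positivity
    have a2 : 0 ≤ μ * (1 - μ) * C' * ‖y - z‖ ^ 2 := by positivity
    rw [abs_le]
    constructor <;> nlinarith)
  have hf := aux_fderiv u x _ _ (by positivity) L hL
  intro v hv
  rw [hf.fderiv]
  exact ⟨hL v hv, hf.differentiableAt⟩

/-- if both `u` and `-u` are locally semiconcave on the open set `U`, then `u` is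
`C^{1,1}_loc` on `U`: it is differentiable on `U` and its gradient is locally Lipschitz on `U`. -/
theorem stmt_5 {n : ℕ} (U : Set (E n)) (hU : IsOpen U) (u : E n → ℝ)
    (hu : LocallySemiconcaveOn U u) (hu' : LocallySemiconcaveOn U (fun x => -u x)) :
    (∀ x ∈ U, DifferentiableAt ℝ u x) ∧ LocallyLipschitzOn U (fun x => ∇ u x) := by
  refine ⟨fun x hx => ?_, fun x₀ hx₀ => ?_⟩
  · obtain ⟨r, hr, K, hK, h⟩ := aux_local U u hu hu' x hx
    exact (h x (Metric.mem_ball_self hr) 0 (by simpa using hr)).2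
  · obtain ⟨r, hr, K, hK, h⟩ := aux_local U u hu hu' x₀ hx₀
    refine ⟨(6 * K).toNNReal, Metric.ball x₀ (r / 4),
      mem_nhdsWithin_of_mem_nhds (Metric.ball_mem_nhds _ (by positivity)), ?_⟩
    refine LipschitzOnWith.of_dist_le_mul fun x hx y hy => ?_
    rw [Real.coe_toNNReal _ (by positivity)]
    unfold gradient
    rw [LinearIsometryEquiv.dist_map, dist_eq_norm, dist_eq_norm]
    have hsub : Metric.ball x₀ (r / 4) ⊆ Metric.ball x₀ r :=
      Metric.ball_subset_ball (by linarith)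
    have hxy : ‖x - y‖ < r / 2 := by
      have := dist_triangle_right x y x₀
      rw [dist_eq_norm] at this
      linarith [Metric.mem_ball.1 hx, Metric.mem_ball.1 hy]
    refine ContinuousLinearMap.opNorm_le_of_unit_norm (by positivity) fun w hw => ?_
    rcases eq_or_ne x y with rfl | hne
    · simp
    set s := ‖x - y‖ with hs
    have hs0 : 0 < s := norm_pos_iff.2 (sub_ne_zero.2 hne)
    have nz : ‖s • w‖ = s := by rw [norm_smul, hw, Real.norm_eq_abs, abs_of_pos hs0, mul_one]
    have nt : ‖(x - y) + s • w‖ ≤ 2 * s := by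
      have := norm_add_le (x - y) (s • w)
      rw [nz] at this
      linarith
    have h1 := abs_le.1 (h x (hsub hx) (s • w) (by rw [nz]; linarith)).1
    have h2 := abs_le.1 (h y (hsub hy) ((x - y) + s • w) (by linarith)).1
    have h3 := abs_le.1 (h y (hsub hy) (x - y) (by linarith)).1
    have e1 : y + ((x - y) + s • w) = x + s • w := by abel
    have e2 : y + (x - y) = x := by abel
    rw [e1, map_add, map_smul, smul_eq_mul] at h2
    rw [e2, ← hs] at h3
    rw [nz, map_smul, smul_eq_mul] at h1
    have h4 : K * ‖(x - y) + s • w‖ ^ 2 ≤ K * (2 * s) ^ 2 := by gcongr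
    have : |s * ((fderiv ℝ u x - fderiv ℝ u y) w)| ≤ s * (6 * K * s) := by
      rw [ContinuousLinearMap.sub_apply, abs_le]
      constructor <;> nlinarith
    rw [abs_mul, abs_of_pos hs0] at this
    exact le_of_mul_le_mul_left this hs0
end
end

section
/- Let U ⊆ ℝⁿ be open and let u : U → ℝ be locally semiconcave on U. Then the singular set Σ(u) := { x ∈ U : u is not differentiable at x } has Hausdorff dimension at most n − 1. -/
open scoped RealInnerProductSpace ENNReal Gradient
open Set Filter

noncomputable section

lemma diff_of_partials {n : ℕ} {V : Set (E n)} (hV : IsOpen V) {g : E n → ℝ}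
    (hg : ConvexOn ℝ V g) {x : E n} (hx : x ∈ V)
    (h : ∀ i : Fin n, DifferentiableAt ℝ
      (fun t : ℝ => g (x + t • EuclideanSpace.single i (1:ℝ))) 0) :
    DifferentiableAt ℝ g x := by
  rcases Nat.eq_zero_or_pos n with rfl | hn
  · exact (hasFDerivAt_of_subsingleton g x).differentiableAt
  set e : Fin n → E n := fun i => EuclideanSpace.single i (1:ℝ) with he
  set d : Fin n → ℝ := fun i => deriv (fun t : ℝ => g (x + t • e i)) 0 with hd
  let L : E n →L[ℝ] ℝ := ∑ i, d i • (EuclideanSpace.proj i : E n →L[ℝ] ℝ)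
  have hLe : ∀ i, L (e i) = d i := by
    intro i
    simp [L, he, PiLp.single_apply]
  let R : E n → ℝ := fun h => g (x + h) - g x - L h
  let S : Set (E n) := (fun h => x + h) ⁻¹' V
  have hS0 : S ∈ nhds (0 : E n) := by
    have : ContinuousAt (fun h : E n => x + h) 0 := by fun_prop
    exact this (by simpa using hV.mem_nhds hx)
  have hR : ConvexOn ℝ S R := by
    have h1 : ConvexOn ℝ S (fun h => g (x + h)) := hg.translate_right x
    have h2 : ConcaveOn ℝ S (fun h => L h) := L.toLinearMap.concaveOn h1.1
    exact (h1.sub (concaveOn_const (g x) h1.1)).sub h2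
  have hR0 : R 0 = 0 := by simp [R]
  have hRe : ∀ i, ∀ ε > (0:ℝ), ∀ᶠ t in nhds (0:ℝ), |R (t • e i)| ≤ ε * |t| := by
    intro i ε hε
    have h1 := (h i).hasDerivAt
    rw [hasDerivAt_iff_isLittleO_nhds_zero] at h1
    filter_upwards [h1.def hε] with t ht
    have : R (t • e i) = g (x + (0 + t) • e i) - g (x + (0:ℝ) • e i) - t • d i := by
      simp only [R, map_smul, hLe]; simp
    rw [this]
    simpa [he, hd] using ht
  have hn' : (0:ℝ) < n := by exact_mod_cast hn
  have hup : ∀ ε > (0:ℝ), ∀ᶠ v in nhds (0 : E n), R v ≤ ε * ‖v‖ := by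
    intro ε hε
    have hε' : 0 < ε / n := by positivity
    have hc : ∀ i, Tendsto (fun v : E n => (n * v i : ℝ)) (nhds 0) (nhds 0) := by
      intro i
      have : Continuous (fun v : E n => (n * v i : ℝ)) := by fun_prop
      simpa using this.tendsto 0
    have hc2 : ∀ i, Tendsto (fun v : E n => (n * v i : ℝ) • e i) (nhds 0) (nhds 0) := by
      intro i
      have : Continuous (fun v : E n => (n * v i : ℝ) • e i) := by fun_prop
      simpa using this.tendsto 0
    have e1 : ∀ᶠ v in nhds (0 : E n), ∀ i, |R ((n * v i : ℝ) • e i)| ≤ ε / n * |(n : ℝ) * v i| :=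
      eventually_all.2 fun i => (hc i).eventually (hRe i _ hε')
    have e2 : ∀ᶠ v in nhds (0 : E n), ∀ i, (n * v i : ℝ) • e i ∈ S :=
      eventually_all.2 fun i => (hc2 i).eventually hS0
    filter_upwards [e1, e2] with v hv1 hv2
    have hsum : ∑ i : Fin n, (1 / n : ℝ) • ((n * v i : ℝ) • e i) = v := by
      ext j
      simp [he, Pi.single_apply, hn'.ne']
    have hJ := hR.map_sum_le (t := Finset.univ) (w := fun _ : Fin n => (1 / n : ℝ))
      (p := fun i => (n * v i : ℝ) • e i) (fun i _ => by positivity)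
      (by simp [hn'.ne']) (fun i _ => hv2 i)
    rw [hsum] at hJ
    refine hJ.trans ?_
    have : ∀ i ∈ (Finset.univ : Finset (Fin n)),
        (1 / n : ℝ) • R ((n * v i : ℝ) • e i) ≤ (1 / n : ℝ) * (ε * ‖v‖) := by
      intro i _
      rw [smul_eq_mul]
      gcongr
      refine (le_abs_self _).trans ((hv1 i).trans ?_)
      rw [abs_mul, abs_of_pos hn']
      have : |v i| ≤ ‖v‖ := by simpa using PiLp.norm_apply_le v i
      calc ε / n * (n * |v i|) = ε * |v i| := by field_simp
        _ ≤ _ := by gcongr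
    refine (Finset.sum_le_sum this).trans ?_
    simp
    field_simp
    rfl
  have hF : HasFDerivAt g L x := by
    rw [hasFDerivAt_iff_isLittleO_nhds_zero]
    rw [Asymptotics.isLittleO_iff]
    intro ε hε
    have hneg : Tendsto (fun v : E n => -v) (nhds 0) (nhds 0) := by
      simpa using (continuous_neg (G := E n)).tendsto 0
    filter_upwards [hup ε hε, hneg.eventually (hup ε hε), hS0, hneg.eventually hS0]
      with v h1 h2 h3 h4
    have h5 := hR.2 h3 h4 (by norm_num : (0:ℝ) ≤ 1/2) (by norm_num : (0:ℝ) ≤ 1/2) (by norm_num)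
    have h6 : (1/2 : ℝ) • v + (1/2:ℝ) • (-v) = 0 := by simp
    rw [h6, hR0] at h5
    simp only [smul_eq_mul] at h5
    rw [norm_neg] at h2
    change |R v| ≤ _
    rw [abs_le]
    constructor <;> linarith
  exact hF.differentiableAt

lemma exists_slopes {n : ℕ} {V : Set (E n)} (hV : IsOpen V) {g : E n → ℝ}
    (hg : ConvexOn ℝ V g) {x : E n} (hx : x ∈ V) (e : E n)
    (h : ¬ DifferentiableAt ℝ (fun t : ℝ => g (x + t • e)) 0) :
    ∃ a b : ℚ, a < b ∧ ∀ t : ℝ, 0 < t → (x + t • e ∈ V → g x + b * t ≤ g (x + t • e)) ∧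
      (x - t • e ∈ V → g x - a * t ≤ g (x - t • e)) := by
  set f : ℝ → ℝ := fun t : ℝ => g (x + t • e) with hf
  let S : Set ℝ := (fun t : ℝ => x + t • e) ⁻¹' V
  have hSo : IsOpen S := hV.preimage (by fun_prop)
  have hfS : ConvexOn ℝ S f := by
    have h1 := (hg.translate_right x)
    exact h1.comp_linearMap (LinearMap.toSpanSingleton ℝ (E n) e)
  have h0 : (0:ℝ) ∈ interior S := by
    rw [hSo.interior_eq]; simpa [S] using hx
  have hlr := hfS.leftDeriv_le_rightDeriv_of_mem_interior h0
  have hr := hfS.hasDerivWithinAt_rightDeriv_of_mem_interior h0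
  have hl := hfS.hasDerivWithinAt_leftDeriv_of_mem_interior h0
  have hlt : derivWithin f (Iio 0) 0 < derivWithin f (Ioi 0) 0 := by
    refine lt_of_le_of_ne hlr fun heq => h ?_
    rw [heq] at hl
    have := (hl.union hr)
    have h2 : HasDerivAt f (derivWithin f (Ioi 0) 0) 0 := by
      rw [Iio_union_Ioi] at this
      rw [hasDerivAt_iff_tendsto_slope]
      rw [hasDerivWithinAt_iff_tendsto_slope] at this
      simpa using this
    exact h2.differentiableAt
  obtain ⟨a, ha1, ha2⟩ := exists_rat_btwn hlt
  obtain ⟨b, hb1, hb2⟩ := exists_rat_btwn ha2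
  refine ⟨a, b, by exact_mod_cast hb1, fun t ht => ⟨fun hm => ?_, fun hm => ?_⟩⟩
  · have := hfS.rightDeriv_le_slope_of_mem_interior h0 (y := t) hm ht
    rw [slope_def_field, le_div_iff₀ (by linarith)] at this
    simp only [hf, zero_smul, add_zero, sub_zero] at this
    nlinarith
  · have := hfS.slope_le_leftDeriv_of_mem_interior (x := -t) (y := 0)
      (by simpa [S, sub_eq_add_neg] using hm) h0 (by linarith)
    rw [slope_def_field, div_le_iff₀ (by linarith)] at this
    simp only [hf, zero_smul, add_zero, zero_sub, neg_neg, neg_smul, ← sub_eq_add_neg] at this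
    nlinarith

lemma dimH_slopes {n : ℕ} {x₀ : E n} {r : ℝ} {g : E n → ℝ} {K : NNReal}
    (hK : LipschitzOnWith K g (Metric.ball x₀ (3 * r))) (e : E n) (he : ‖e‖ = 1) (a b : ℝ)
    (hab : a < b) {A : Set (E n)} (hA : A ⊆ Metric.ball x₀ r)
    (h : ∀ x ∈ A, ∀ t : ℝ, 0 < t →
      (x + t • e ∈ Metric.ball x₀ (3 * r) → g x + b * t ≤ g (x + t • e)) ∧
      (x - t • e ∈ Metric.ball x₀ (3 * r) → g x - a * t ≤ g (x - t • e))) :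
    dimH A ≤ (n : ℝ≥0∞) - 1 := by
  let W : Submodule ℝ (E n) := (Submodule.span ℝ {e})ᗮ
  let P := W.orthogonalProjectionOnto
  have hP : ∀ v, ((P v : W) : E n) = v - inner ℝ e v • e := by
    intro v
    have := Submodule.starProjection_orthogonal_val (K := Submodule.span ℝ {e}) v
    rw [Submodule.starProjection_unit_singleton ℝ he] at this
    exact this
  -- key cone estimate
  have key : ∀ x ∈ A, ∀ y ∈ A, 0 < inner ℝ e (y - x) →
      (b - a) * inner ℝ e (y - x) ≤ 2 * K * ‖P (y - x)‖ := by
    intro x hx y hy ht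
    set t := inner ℝ e (y - x) with htdef
    have hw : ‖P (y - x)‖ = ‖(y - x) - t • e‖ := by
      rw [htdef, ← hP]; rfl
    have htn : t ≤ ‖y - x‖ := by
      have := real_inner_le_norm e (y - x)
      rwa [he, one_mul] at this
    have hx0 := hA hx
    have hy0 := hA hy
    rw [Metric.mem_ball, dist_eq_norm] at hx0 hy0
    have hxy : ‖y - x‖ < 2 * r := by
      calc ‖y - x‖ = ‖(y - x₀) - (x - x₀)‖ := by congr 1; abel
        _ ≤ ‖y - x₀‖ + ‖x - x₀‖ := norm_sub_le _ _
        _ < 2 * r := by linarith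
    have hte : ‖t • e‖ < 2 * r := by
      rw [norm_smul, he, mul_one, Real.norm_of_nonneg ht.le]; linarith
    have hxm : x + t • e ∈ Metric.ball x₀ (3 * r) := by
      rw [Metric.mem_ball, dist_eq_norm]
      calc ‖x + t • e - x₀‖ = ‖(x - x₀) + t • e‖ := by congr 1; abel
        _ ≤ ‖x - x₀‖ + ‖t • e‖ := norm_add_le _ _
        _ < _ := by linarith
    have hym : y - t • e ∈ Metric.ball x₀ (3 * r) := by
      rw [Metric.mem_ball, dist_eq_norm]
      calc ‖y - t • e - x₀‖ = ‖(y - x₀) - t • e‖ := by congr 1; abel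
        _ ≤ ‖y - x₀‖ + ‖t • e‖ := norm_sub_le _ _
        _ < _ := by linarith
    have hr : 0 < r := lt_of_le_of_lt (norm_nonneg _) hx0
    have hxb : x ∈ Metric.ball x₀ (3 * r) := by
      rw [Metric.mem_ball, dist_eq_norm]; linarith
    have hyb : y ∈ Metric.ball x₀ (3 * r) := by
      rw [Metric.mem_ball, dist_eq_norm]; linarith
    have h1 := (h x hx t ht).1 hxm
    have h2 := (h y hy t ht).2 hym
    have h3 := hK.dist_le_mul _ hxm _ hyb
    have h4 := hK.dist_le_mul _ hym _ hxb
    rw [dist_comm (x + t • e) y, dist_eq_norm y, sub_add_eq_sub_sub, ← hw, Real.dist_eq] at h3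
    rw [dist_eq_norm (y - t • e), sub_right_comm, ← hw, Real.dist_eq] at h4
    have h5 := le_abs_self (g (x + t • e) - g y)
    have h6 := le_abs_self (g (y - t • e) - g x)
    nlinarith
  have key2 : ∀ x ∈ A, ∀ y ∈ A,
      (b - a) * |inner ℝ e (y - x)| ≤ 2 * K * ‖P (y - x)‖ := by
    intro x hx y hy
    rcases lt_trichotomy (inner ℝ e (y - x)) 0 with h0 | h0 | h0
    · have h1 : inner ℝ e (x - y) = - inner ℝ e (y - x) := by
        rw [← inner_neg_right, neg_sub]
      have := key y hy x hx (by rw [h1]; linarith)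
      rw [abs_of_neg h0, ← h1]
      rwa [← neg_sub y x, map_neg, norm_neg, neg_sub] at this
    · rw [h0]; simp; positivity
    · rw [abs_of_pos h0]; exact key x hx y hy h0
  let M : NNReal := (2 * K / (b - a) + 1 : ℝ).toNNReal
  have hba : 0 < b - a := by linarith
  have hanti : AntilipschitzWith M (fun z : A => P z) := by
    refine AntilipschitzWith.of_le_mul_dist fun y x => ?_
    have hk := key2 x x.2 y y.2
    rw [Subtype.dist_eq, dist_eq_norm, dist_eq_norm, ← map_sub]
    have hM : (M : ℝ) = 2 * K / (b - a) + 1 := Real.coe_toNNReal _ (by positivity)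
    rw [hM]
    set v : E n := (y : E n) - x
    have hv : v = inner ℝ e v • e + (P v : E n) := by rw [hP]; abel
    have h1 : ‖v‖ ≤ |inner ℝ e v| + ‖P v‖ := by
      calc ‖v‖ = ‖inner ℝ e v • e + (P v : E n)‖ := by rw [← hv]
        _ ≤ ‖inner ℝ e v • e‖ + ‖(P v : E n)‖ := norm_add_le _ _
        _ = _ := by rw [norm_smul, he, mul_one]; rfl
    have h2 : |inner ℝ e v| ≤ 2 * K / (b - a) * ‖P v‖ := by
      rw [div_mul_eq_mul_div, le_div_iff₀ hba]; linarith
    linarith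
  have hA1 : dimH A = dimH (univ : Set A) := by
    have := (isometry_subtype_coe (s := A)).dimH_image univ
    rwa [image_univ, Subtype.range_coe] at this
  have he0 : e ≠ 0 := by rintro rfl; simp at he
  have hfin : Module.finrank ℝ W + 1 = n := by
    have := Submodule.finrank_add_finrank_orthogonal (Submodule.span ℝ {e})
    rw [finrank_span_singleton he0] at this
    rw [finrank_euclideanSpace_fin] at this
    change Module.finrank ℝ (Submodule.span ℝ {e})ᗮ + 1 = n
    omega
  calc dimH A = dimH (univ : Set A) := hA1
    _ ≤ dimH ((fun z : A => P z) '' univ) := hanti.le_dimH_image _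
    _ ≤ dimH (univ : Set W) := dimH_mono (subset_univ _)
    _ = Module.finrank ℝ W := Real.dimH_univ_eq_finrank W
    _ = (n : ℝ≥0∞) - 1 := by
      have h1 : (n : ℝ≥0∞) = (Module.finrank ℝ W : ℝ≥0∞) + 1 := by exact_mod_cast hfin.symm
      exact ENNReal.eq_sub_of_add_eq (by simp) h1.symm

lemma local_dimH {n : ℕ} {V : Set (E n)} (hV : IsOpen V) {g : E n → ℝ}
    (hg : ConvexOn ℝ V g) {x₀ : E n} (hx : x₀ ∈ V) :
    ∃ r > 0, Metric.ball x₀ r ⊆ V ∧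
      dimH {x | x ∈ Metric.ball x₀ r ∧ ¬ DifferentiableAt ℝ g x} ≤ (n : ℝ≥0∞) - 1 := by
  obtain ⟨K, T, hT, hK⟩ := hg.locallyLipschitzOn hV hx
  rw [hV.nhdsWithin_eq hx] at hT
  obtain ⟨ρ, hρ, hρs⟩ := Metric.mem_nhds_iff.1 (inter_mem hT (hV.mem_nhds hx))
  have h3 : 3 * (ρ / 3) = ρ := by ring
  have hsub : Metric.ball x₀ (ρ / 3) ⊆ V :=
    (Metric.ball_subset_ball (by linarith)).trans (hρs.trans inter_subset_right)
  refine ⟨ρ / 3, by positivity, hsub, ?_⟩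
  have hcov : {x | x ∈ Metric.ball x₀ (ρ / 3) ∧ ¬ DifferentiableAt ℝ g x} ⊆
      ⋃ q : Fin n × {q : ℚ × ℚ // q.1 < q.2}, {x | x ∈ Metric.ball x₀ (ρ / 3) ∧
        ∀ t : ℝ, 0 < t →
          (x + t • EuclideanSpace.single q.1 (1:ℝ) ∈ Metric.ball x₀ (3 * (ρ / 3)) →
            g x + (q.2.1.2 : ℝ) * t ≤ g (x + t • EuclideanSpace.single q.1 (1:ℝ))) ∧
          (x - t • EuclideanSpace.single q.1 (1:ℝ) ∈ Metric.ball x₀ (3 * (ρ / 3)) →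
            g x - (q.2.1.1 : ℝ) * t ≤ g (x - t • EuclideanSpace.single q.1 (1:ℝ)))} := by
    rintro x ⟨hxb, hxd⟩
    have : ∃ i : Fin n, ¬ DifferentiableAt ℝ
      (fun t : ℝ => g (x + t • EuclideanSpace.single i (1:ℝ))) 0 := by
      by_contra! hc
      exact hxd (diff_of_partials hV hg (hsub hxb) hc)
    obtain ⟨i, hi⟩ := this
    obtain ⟨a, b, hab, H⟩ := exists_slopes hV hg (hsub hxb) _ hi
    refine mem_iUnion.2 ⟨(i, ⟨(a, b), hab⟩), hxb, fun t ht => ?_⟩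
    rw [h3]
    exact ⟨fun hm => (H t ht).1 (hρs hm).2, fun hm => (H t ht).2 (hρs hm).2⟩
  refine (dimH_mono hcov).trans ?_
  rw [dimH_iUnion]
  refine iSup_le fun q => ?_
  refine dimH_slopes (x₀ := x₀) (r := ρ / 3) (g := g) (K := K) ?_
    (EuclideanSpace.single q.1 (1:ℝ)) (by simp) q.2.1.1 q.2.1.2 (by exact_mod_cast q.2.2)
    (fun x hx => hx.1) (fun x hx => hx.2)
  rw [h3]
  exact hK.mono (hρs.trans inter_subset_left)

lemma convex_of_semiconcave {n : ℕ} {V : Set (E n)} (hV : Convex ℝ V) {C : ℝ} {u : E n → ℝ}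
    (hu : IsSemiconcaveOn C V u) : ConvexOn ℝ V (fun x => C * ‖x‖ ^ 2 - u x) := by
  refine ⟨hV, fun x hx y hy a b ha hb hab => ?_⟩
  have hb' : b = 1 - a := by linarith
  subst hb'
  have h := hu x hx y hy a ⟨ha, by linarith⟩
  have h1 : ‖a • x + (1 - a) • y‖ ^ 2 =
      a * ‖x‖ ^ 2 + (1 - a) * ‖y‖ ^ 2 - a * (1 - a) * ‖x - y‖ ^ 2 := by
    rw [norm_add_sq_real, norm_sub_sq_real, norm_smul, norm_smul, inner_smul_left,
      inner_smul_right, mul_pow, mul_pow, Real.norm_eq_abs, Real.norm_eq_abs, sq_abs, sq_abs]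
    simp only [conj_trivial]
    ring
  simp only [smul_eq_mul]
  rw [h1]
  linarith

/-- the singular set (set of non-differentiability points) of a locally
semiconcave function on an open set `U ⊆ ℝⁿ` has Hausdorff dimension at most `n - 1`. -/
theorem stmt_6 {n : ℕ} (U : Set (E n)) (hU : IsOpen U) (u : E n → ℝ)
    (hu : LocallySemiconcaveOn U u) :
    dimH {x | x ∈ U ∧ ¬ DifferentiableAt ℝ u x} ≤ (n : ℝ≥0∞) - 1 := by
  have hloc : ∀ x : E n, x ∈ U → ∃ r > 0,
      dimH {y | y ∈ Metric.ball x r ∧ ¬ DifferentiableAt ℝ u y} ≤ (n : ℝ≥0∞) - 1 := by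
    intro x hx
    obtain ⟨V, hVo, hVc, hxV, -, C, -, hC⟩ := hu x hx
    obtain ⟨r, hr, -, hd⟩ := local_dimH hVo (convex_of_semiconcave hVc hC) hxV
    refine ⟨r, hr, (dimH_mono ?_).trans hd⟩
    rintro y ⟨hy, hyd⟩
    refine ⟨hy, fun hd => hyd ?_⟩
    have h1 : DifferentiableAt ℝ (fun x : E n => C * ‖x‖ ^ 2) y :=
      (differentiableAt_id.norm_sq ℝ).const_mul C
    have h2 := h1.sub hd
    refine h2.congr_of_eventuallyEq (Eventually.of_forall fun z => ?_)
    simp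
  choose! r hr hd using hloc
  obtain ⟨T, hTU, hTc, hcov⟩ := TopologicalSpace.countable_cover_nhdsWithin
    (f := fun x => Metric.ball x (r x)) (s := U)
    (fun x hx => mem_nhdsWithin_of_mem_nhds (Metric.ball_mem_nhds x (hr x hx)))
  have hs : {x | x ∈ U ∧ ¬ DifferentiableAt ℝ u x} ⊆
      ⋃ x ∈ T, {y | y ∈ Metric.ball x (r x) ∧ ¬ DifferentiableAt ℝ u y} := by
    rintro y ⟨hy, hyd⟩
    obtain ⟨x, hxT, hyx⟩ := mem_iUnion₂.1 (hcov hy)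
    exact mem_iUnion₂.2 ⟨x, hxT, hyx, hyd⟩
  refine (dimH_mono hs).trans ?_
  rw [dimH_bUnion hTc]
  exact iSup₂_le fun x hx => hd x (hTU hx)
end
end

section
/- Let U ⊆ ℝⁿ be open, let u : U → ℝ be locally semiconcave on U, let γ : [a,b] → U be a Lipschitz curve (a < b), and let p : [a,b] → ℝⁿ be a measurable map with p(t) ∈ D⁺u(γ(t)) for almost every t ∈ [a,b]. Then for almost every t ∈ [a,b], the functions t ↦ u(γ(t)) and γ are differentiable at t and (u ∘ γ)'(t) = ⟨p(t), γ'(t)⟩. -/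
open scoped RealInnerProductSpace ENNReal Gradient
open Set Filter

noncomputable section

lemma locLip_aux {n : ℕ} (V : Set (E n)) (hV : IsOpen V) (hc : Convex ℝ V) (u : E n → ℝ) (C : ℝ)
    (h : IsSemiconcaveOn C V u) : LocallyLipschitzOn V u := by
  have h1 : ConcaveOn ℝ V (fun x => u x - C * ‖x‖ ^ 2) := by
    refine ⟨hc, ?_⟩
    intro x hx y hy α β hα hβ hαβ
    have hb : β = 1 - α := by linarith
    subst hb
    have h2 := h x hx y hy α ⟨hα, by linarith⟩
    have h3 : ‖α • x + (1 - α) • y‖ ^ 2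
        = α * ‖x‖ ^ 2 + (1 - α) * ‖y‖ ^ 2 - α * (1 - α) * ‖x - y‖ ^ 2 := by
      rw [norm_add_sq_real, norm_sub_sq_real, norm_smul, norm_smul, real_inner_smul_left,
        real_inner_smul_right, mul_pow, mul_pow, Real.norm_eq_abs, Real.norm_eq_abs, sq_abs, sq_abs]
      ring
    simp only [smul_eq_mul]
    rw [h3]
    nlinarith
  have h2 := h1.locallyLipschitzOn hV
  have h3 : LocallyLipschitz (fun x : E n => C * ‖x‖ ^ 2) := by
    have : ContDiff ℝ 1 (fun x : E n => C * ‖x‖ ^ 2) := contDiff_const.mul (contDiff_norm_sq ℝ)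
    exact this.locallyLipschitz
  have h4 := h2.add (h3.locallyLipschitzOn (s := V))
  have h5 : ((fun x => u x - C * ‖x‖ ^ 2) + (fun x : E n => C * ‖x‖ ^ 2)) = u := by
    funext x; simp
  first
  | (rw [h5] at h4; exact h4)
  | simpa using h4

lemma deriv_zero_aux (g : ℝ → ℝ) (d t K : ℝ) (hK : 0 ≤ K) (hg : HasDerivAt g d t)
    (h : ∀ ε > 0, ∀ᶠ s in nhds t, g s - g t ≤ ε * (K * |s - t|)) : d = 0 := by
  have key : ∀ ε > 0, |d| ≤ ε * (K + 1) := by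
    intro ε hε
    have h1 := (hasDerivAt_iff_isLittleO.1 hg).def hε
    obtain ⟨δ, hδ, hb⟩ := Metric.eventually_nhds_iff.1 (h1.and (h ε hε))
    have e : ∀ s : ℝ, |s - t| = δ / 2 → d * (s - t) ≤ ε * (K + 1) * (δ / 2) := by
      intro s hs
      have := hb (y := s) (by rw [Real.dist_eq, hs]; linarith)
      rw [Real.norm_eq_abs, Real.norm_eq_abs, hs, smul_eq_mul] at this
      have h2 := (abs_le.1 this.1).1
      nlinarith [this.2]
    have e1 := e (t + δ / 2) (by rw [add_sub_cancel_left, abs_of_pos (by linarith)])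
    have e2 := e (t - δ / 2) (by
      rw [show t - δ / 2 - t = -(δ / 2) by ring, abs_neg, abs_of_pos (by linarith)])
    rw [abs_le]
    constructor <;> nlinarith
  by_contra hd
  have h0 : 0 < |d| := abs_pos.2 hd
  have := key (|d| / (2 * (K + 1))) (by positivity)
  have h3 : |d| / (2 * (K + 1)) * (K + 1) = |d| / 2 := by field_simp
  linarith

/-- if `u` is locally semiconcave on the open set `U`, `γ : [a,b] → U` is a
Lipschitz curve and `p` is measurable with `p t ∈ D⁺u(γ t)` for a.e. `t`, then for a.e.
`t ∈ [a,b]` the curves `γ` and `u ∘ γ` are differentiable at `t` and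
`(u ∘ γ)'(t) = ⟪p t, γ'(t)⟫`. -/
theorem stmt_7 {n : ℕ} (U : Set (E n)) (hU : IsOpen U) (u : E n → ℝ)
    (hu : LocallySemiconcaveOn U u) (a b : ℝ) (hab : a < b) (γ : ℝ → E n)
    (K : NNReal) (hγ : LipschitzOnWith K γ (Icc a b)) (hγU : ∀ t ∈ Icc a b, γ t ∈ U)
    (p : ℝ → E n) (hp : Measurable p)
    (hpD : ∀ᵐ t ∂(MeasureTheory.volume.restrict (Icc a b)), p t ∈ superdiff u (γ t)) :
    ∀ᵐ t ∂(MeasureTheory.volume.restrict (Icc a b)),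
      ∃ q : E n, HasDerivWithinAt γ q (Icc a b) t ∧
        HasDerivWithinAt (fun s => u (γ s)) (⟪p t, q⟫) (Icc a b) t := by
  have hA := hγ.ae_differentiableWithinAt (μ := MeasureTheory.volume) measurableSet_Icc
  have hB : ∀ᵐ t ∂(MeasureTheory.volume.restrict (Icc a b)),
      DifferentiableWithinAt ℝ (fun s => u (γ s)) (Icc a b) t := by
    rw [MeasureTheory.ae_restrict_iff' measurableSet_Icc, MeasureTheory.ae_iff]
    apply MeasureTheory.measure_null_of_locally_null
    intro t ht
    have htI : t ∈ Icc a b := by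
      by_contra hh
      exact ht fun h => absurd h hh
    obtain ⟨V, hVo, hVc, htV, hVU, C, hC, hVs⟩ := hu _ (hγU t htI)
    obtain ⟨L, W, hW, hL⟩ := locLip_aux V hVo hVc u C hVs htV
    rw [hVo.nhdsWithin_eq htV] at hW
    have hcont := hγ.continuousOn t htI
    have hpre := hcont hW
    obtain ⟨O, hO, htO, hOs⟩ := mem_nhdsWithin.1 hpre
    have hl : LipschitzOnWith (L * K) (u ∘ γ) (O ∩ Icc a b) :=
      hL.comp (hγ.mono inter_subset_right) (fun s hs => hOs hs)
    have hae := hl.ae_differentiableWithinAt_of_mem (μ := MeasureTheory.volume)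
    rw [MeasureTheory.ae_iff] at hae
    refine ⟨_, ?_, hae⟩
    refine mem_nhdsWithin.2 ⟨O, hO, htO, ?_⟩
    rintro s ⟨hsO, hs⟩ hcon
    apply hs
    intro hsI
    have := hcon ⟨hsO, hsI⟩
    rw [inter_comm] at this
    exact (differentiableWithinAt_inter (hO.mem_nhds hsO)).1 this
  have hna : ∀ᵐ t ∂(MeasureTheory.volume.restrict (Icc a b)), t ≠ a :=
    MeasureTheory.ae_restrict_of_ae (MeasureTheory.Measure.ae_ne _ a)
  have hnb : ∀ᵐ t ∂(MeasureTheory.volume.restrict (Icc a b)), t ≠ b :=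
    MeasureTheory.ae_restrict_of_ae (MeasureTheory.Measure.ae_ne _ b)
  filter_upwards [hA, hB, hna, hnb, hpD, MeasureTheory.ae_restrict_mem measurableSet_Icc]
    with t h1 h2 h3 h4 h5 h6
  refine ⟨_, h1.hasDerivWithinAt, ?_⟩
  have hn : Icc a b ∈ nhds t := Icc_mem_nhds (lt_of_le_of_ne h6.1 h3.symm) (lt_of_le_of_ne h6.2 h4)
  have d1 := h1.hasDerivWithinAt.hasDerivAt hn
  have d2 := h2.hasDerivWithinAt.hasDerivAt hn
  generalize derivWithin γ (Icc a b) t = q at *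
  have hd3 : HasDerivAt (fun s => ⟪p t, γ s⟫) ⟪p t, q⟫ t := by
    simpa using (hasDerivAt_const t (p t)).inner ℝ d1
  have hd4 := d2.sub hd3
  have := deriv_zero_aux _ _ t K K.2 hd4 (by
    intro ε hε
    filter_upwards [d1.continuousAt.eventually (h5 ε hε), hn] with s hs hsI
    have hk := hγ.dist_le_mul s hsI t h6
    rw [dist_eq_norm, Real.dist_eq] at hk
    rw [inner_sub_right] at hs
    have := mul_le_mul_of_nonneg_left hk hε.le
    simp only [Pi.sub_apply]
    linarith)
  rw [sub_eq_zero] at this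
  rw [← this]
  exact h2.hasDerivWithinAt
end
end

section
/- Fix smooth vector fields f₁, …, f_m : ℝⁿ → ℝⁿ, a point x̄ ∈ ℝⁿ, and p₀ ∈ ℝⁿ with H(x̄, p₀) ≠ 0, where H(x,p) := (1/2)·Σᵢ ⟨p, fᵢ(x)⟩². Then there exist an open neighborhood W of p₀ in ℝⁿ, ε > 0, and ρ > 0 such that: every normal extremal (x(·), p(·)) defined on [0, ε] with x(0) = x̄ and p(0) ∈ W satisfies x(t) ∈ B(x̄, ρ) for all t ∈ [0, ε], and for every bounded measurable control u : [0, ε] → ℝᵐ whose trajectory y : [0, ε] → ℝⁿ satisfies y(0) = x̄, y(t) ∈ B(x̄, ρ) for all t, and y(ε) = x(ε), one has ∫₀^ε Σᵢ ⟨p(t), fᵢ(x(t))⟩² dt ≤ ∫₀^ε Σᵢ uᵢ(t)² dt. -/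
open scoped RealInnerProductSpace ENNReal Gradient
open Set Filter

noncomputable section

/-- The Hamiltonian `H(x,p) = (1/2) Σᵢ ⟪p, fᵢ(x)⟫²`. -/
def Ham {n m : ℕ} (f : Fin m → E n → E n) (x p : E n) : ℝ :=
  (1 / 2) * ∑ i, ⟪p, f i x⟫ ^ 2

/-- `(x, p)` is a normal extremal on the set `s ⊆ ℝ`: it solves the Hamiltonian system
`x' = Σᵢ ⟪p, fᵢ(x)⟫ fᵢ(x)`, `p' = -Σᵢ ⟪p, fᵢ(x)⟫ (Dfᵢ(x))ᵀ p` on `s`. -/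
def IsNormalExtremalOn {n m : ℕ} (f : Fin m → E n → E n) (x p : ℝ → E n)
    (s : Set ℝ) : Prop :=
  ∀ t ∈ s,
    HasDerivWithinAt x (∑ i, ⟪p t, f i (x t)⟫ • f i (x t)) s t ∧
    HasDerivWithinAt p
      (-∑ i, ⟪p t, f i (x t)⟫ • (ContinuousLinearMap.adjoint (fderiv ℝ (f i) (x t))) (p t))
      s t

/-- A bounded measurable control on `[0, T]`. -/
def IsBoundedControl {m : ℕ} (T : ℝ) (u : ℝ → Fin m → ℝ) : Prop :=
  Measurable u ∧ ∃ K : ℝ, ∀ t ∈ Icc (0:ℝ) T, ‖u t‖ ≤ K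

/-- `y` is a trajectory on `[0, T]` of the control `u` for the vector fields `f`, i.e. an
absolutely continuous curve with `y' (t) = Σᵢ uᵢ(t) fᵢ(y t)` a.e., expressed in integral form. -/
def IsTrajectoryOn {n m : ℕ} (f : Fin m → E n → E n) (u : ℝ → Fin m → ℝ) (T : ℝ)
    (y : ℝ → E n) : Prop :=
  ContinuousOn y (Icc 0 T) ∧
  ∀ t ∈ Icc (0:ℝ) T, y t = y 0 + ∫ s in (0:ℝ)..t, ∑ i, u s i • f i (y s)

/-- The value function `V(x) ∈ [0, +∞]`: the infimum of the cost `∫₀¹ Σᵢ uᵢ(t)² dt` over all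
bounded measurable controls on `[0,1]` admitting a trajectory from `x̄` to `x`. -/
def valueFun {n m : ℕ} (f : Fin m → E n → E n) (xbar : E n) (x : E n) : ℝ≥0∞ :=
  sInf { c : ℝ≥0∞ | ∃ u : ℝ → Fin m → ℝ, IsBoundedControl 1 u ∧
    ∃ y : ℝ → E n, IsTrajectoryOn f u 1 y ∧ y 0 = xbar ∧ y 1 = x ∧
      c = ENNReal.ofReal (∫ t in (0:ℝ)..1, ∑ i, (u t i) ^ 2) }

open MeasureTheory

/-- Quadratic Taylor bound for smooth functions on closed balls. -/
lemma taylor_ball {V : Type*} [NormedAddCommGroup V] [NormedSpace ℝ V] [ProperSpace V]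
    (h : V → ℝ) (hh : ContDiff ℝ (⊤ : ℕ∞) h) (w : V) (R : ℝ) :
    ∃ C : ℝ, 0 ≤ C ∧ ∀ a ∈ Metric.closedBall w R, ∀ b ∈ Metric.closedBall w R,
      h b ≤ h a + fderiv ℝ h a (b - a) + C * ‖b - a‖ ^ 2 := by
  have h1 : ContDiff ℝ 1 (fderiv ℝ h) := hh.fderiv_right (by norm_cast)
  obtain ⟨K, hK⟩ := h1.contDiffOn.exists_lipschitzOnWith (s := Metric.closedBall w R)
    (by norm_num) (convex_closedBall _ _) (isCompact_closedBall _ _)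
  refine ⟨K, K.2, fun a ha b hb => ?_⟩
  have hseg : segment ℝ a b ⊆ Metric.closedBall w R := (convex_closedBall w R).segment_subset ha hb
  have := (convex_segment a b).norm_image_sub_le_of_norm_fderiv_le' (𝕜 := ℝ)
    (f := h) (φ := fderiv ℝ h a) (C := K * ‖b - a‖) (x := a) (y := b)
    (fun x _ => (hh.differentiable (by simp)) x) ?_ (left_mem_segment ℝ a b) (right_mem_segment ℝ a b)
  · have h2 := (le_abs_self _).trans this
    nlinarith [h2]
  · intro c hc
    have h3 := hK.norm_sub_le (hseg hc) ha
    refine h3.trans ?_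
    gcongr
    obtain ⟨s, hs, rfl⟩ := (segment_eq_image' ℝ a b ▸ hc)
    simp only [add_sub_cancel_left, norm_smul, Real.norm_eq_abs, abs_of_nonneg hs.1]
    exact mul_le_of_le_one_left (norm_nonneg _) hs.2

lemma ham_contDiff {n m : ℕ} (f : Fin m → E n → E n) (hf : ∀ i, ContDiff ℝ (⊤ : ℕ∞) (f i)) :
    ContDiff ℝ (⊤ : ℕ∞) (fun w : E n × E n => Ham f w.1 w.2) := by
  unfold Ham
  refine contDiff_const.mul (ContDiff.sum fun i _ => ContDiff.pow ?_ 2)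
  exact contDiff_snd.inner ℝ ((hf i).comp contDiff_fst)

lemma ham_fderiv {n m : ℕ} (f : Fin m → E n → E n) (hf : ∀ i, ContDiff ℝ (⊤ : ℕ∞) (f i))
    (x p a b : E n) :
    fderiv ℝ (fun w : E n × E n => Ham f w.1 w.2) (x, p) (a, b) =
      ∑ i, ⟪p, f i x⟫ * (⟪b, f i x⟫ + ⟪p, fderiv ℝ (f i) x a⟫) := by
  have key : ∀ i, HasFDerivAt (fun w : E n × E n => ⟪w.2, f i w.1⟫)
      ((fderivInnerCLM ℝ (p, f i x)).comp ((ContinuousLinearMap.snd ℝ (E n) (E n)).prod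
        ((fderiv ℝ (f i) x).comp (ContinuousLinearMap.fst ℝ (E n) (E n))))) (x, p) := by
    intro i
    have h1 : HasFDerivAt (fun w : E n × E n => w.2) (ContinuousLinearMap.snd ℝ (E n) (E n)) (x, p) :=
      hasFDerivAt_snd
    have h2 : HasFDerivAt (fun w : E n × E n => f i w.1)
        ((fderiv ℝ (f i) x).comp (ContinuousLinearMap.fst ℝ (E n) (E n))) (x, p) :=
      HasFDerivAt.comp (x, p) (((hf i).differentiable (by simp)) x).hasFDerivAt hasFDerivAt_fst
    exact h1.inner ℝ h2
  have h := (HasFDerivAt.fun_sum (u := Finset.univ) (fun i _ => (key i).pow 2)).const_mul (1/2 : ℝ)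
  have h' : HasFDerivAt (fun w : E n × E n => Ham f w.1 w.2) _ (x, p) := h
  rw [h'.fderiv]
  simp only [ContinuousLinearMap.smul_apply, ContinuousLinearMap.sum_apply, smul_eq_mul,
    Finset.mul_sum]
  refine Finset.sum_congr rfl fun i _ => ?_
  simp [fderivInnerCLM_apply]
  ring

/-- Lipschitz real compositions integrate their derivatives. -/
lemma ac_of_lipschitz {V : Type*} [NormedAddCommGroup V] [NormedSpace ℝ V] [ProperSpace V]
    (Φ : V → ℝ) (hΦ : ContDiff ℝ 1 Φ) (c : ℝ → V) (T : ℝ) (hT : 0 ≤ T) (K : NNReal)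
    (hc : LipschitzOnWith K c (Icc 0 T)) :
    AbsolutelyContinuousOnInterval (fun t => Φ (c t)) 0 T := by
  obtain ⟨L, hL⟩ := hΦ.contDiffOn.exists_lipschitzOnWith (s := Metric.closedBall (c 0) (K * T))
    (by norm_num) (convex_closedBall _ _) (isCompact_closedBall _ _)
  refine LipschitzOnWith.absolutelyContinuousOnInterval (K := L * K) ?_
  rw [uIcc_of_le hT]
  refine hL.comp hc ?_
  intro t ht
  rw [Metric.mem_closedBall]
  have := hc.dist_le_mul t ht 0 ⟨le_rfl, hT⟩
  refine this.trans ?_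
  gcongr
  rw [Real.dist_eq, sub_zero, abs_of_nonneg ht.1]; exact ht.2

/-- Regularity of trajectories. -/
lemma traj_reg {n m : ℕ} (f : Fin m → E n → E n) (hf : ∀ i, ContDiff ℝ (⊤ : ℕ∞) (f i))
    (u : ℝ → Fin m → ℝ) (T : ℝ) (hT : 0 ≤ T) (hu : IsBoundedControl T u) (y : ℝ → E n)
    (hy : IsTrajectoryOn f u T y) :
    (∃ K : NNReal, LipschitzOnWith K y (Icc 0 T)) ∧
    (∀ᵐ t, t ∈ Ioo 0 T → HasDerivAt y (∑ i, u t i • f i (y t)) t) ∧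
    IntervalIntegrable (fun t => ∑ i, (u t i)^2) volume 0 T := by
  obtain ⟨hum, K, hK⟩ := hu
  obtain ⟨hyc, hyi⟩ := hy
  have hub : ∀ t ∈ Icc 0 T, ∀ i, |u t i| ≤ K := fun t ht i =>
    (norm_le_pi_norm (u t) i).trans (hK t ht)
  have hum' : ∀ i, Measurable fun t => u t i := fun i => (measurable_pi_apply i).comp hum
  have hfc : ∀ i, ContinuousOn (fun t => f i (y t)) (Icc 0 T) := fun i =>
    (hf i).continuous.comp_continuousOn hyc
  have hB : ∀ i, ∃ B, ∀ t ∈ Icc 0 T, ‖f i (y t)‖ ≤ B := fun i =>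
    isCompact_Icc.exists_bound_of_continuousOn (hfc i)
  choose B hB using hB
  have hg : ∀ t ∈ Icc 0 T, ‖∑ i, u t i • f i (y t)‖ ≤ ∑ i, |K| * |B i| := by
    intro t ht
    refine (norm_sum_le _ _).trans (Finset.sum_le_sum fun i _ => ?_)
    rw [norm_smul]
    exact mul_le_mul ((hub t ht i).trans (le_abs_self _)) ((hB i t ht).trans (le_abs_self _))
      (norm_nonneg _) (abs_nonneg _)
  have hgm : AEStronglyMeasurable (fun t => ∑ i, u t i • f i (y t))
      (volume.restrict (Icc 0 T)) := by
    refine Finset.aestronglyMeasurable_fun_sum _ fun i _ => ?_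
    exact (hum' i).aestronglyMeasurable.smul ((hfc i).aestronglyMeasurable measurableSet_Icc)
  have hgi : IntegrableOn (fun t => ∑ i, u t i • f i (y t)) (Icc 0 T) :=
    IntegrableOn.of_bound (by simp) hgm _
      ((ae_restrict_iff' measurableSet_Icc).2 (ae_of_all _ hg))
  have hgii : IntervalIntegrable (fun t => ∑ i, u t i • f i (y t)) volume 0 T := by
    rw [intervalIntegrable_iff_integrableOn_Icc_of_le hT]; exact hgi
  refine ⟨⟨Real.toNNReal (∑ i, |K| * |B i|), ?_⟩, ?_, ?_⟩
  · refine LipschitzOnWith.of_dist_le_mul fun s hs t ht => ?_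
    rw [dist_eq_norm, hyi s hs, hyi t ht, add_sub_add_left_eq_sub,
      intervalIntegral.integral_interval_sub_left]
    · rw [Real.coe_toNNReal _ (by positivity), Real.dist_eq]
      refine intervalIntegral.norm_integral_le_of_norm_le_const fun r hr => hg r ?_
      have := uIoc_subset_uIcc hr
      exact uIcc_subset_Icc ht hs this
    · exact hgii.mono_set (by rw [uIcc_of_le hT, uIcc_of_le hs.1]; exact Icc_subset_Icc_right hs.2)
    · exact hgii.mono_set (by rw [uIcc_of_le hT, uIcc_of_le ht.1]; exact Icc_subset_Icc_right ht.2)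
  · filter_upwards [hgii.ae_hasDerivAt_integral] with t ht htm
    have h1 := ht (by rw [uIcc_of_le hT]; exact Ioo_subset_Icc_self htm) 0 (by simp)
    refine (h1.const_add (y 0)).congr_of_eventuallyEq ?_
    filter_upwards [Icc_mem_nhds htm.1 htm.2] with s hs
    exact hyi s hs
  · rw [intervalIntegrable_iff_integrableOn_Icc_of_le hT]
    refine IntegrableOn.of_bound (by simp) ?_ (∑ i : Fin m, K ^ 2)
      ((ae_restrict_iff' measurableSet_Icc).2 (ae_of_all _ fun t ht => ?_))
    · exact (Finset.measurable_fun_sum _ fun i _ => (hum' i).pow_const 2).aestronglyMeasurable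
    · rw [Real.norm_of_nonneg (by positivity)]
      exact Finset.sum_le_sum fun i _ => by
        have := hub t ht i
        exact sq_le_sq.2 (this.trans (le_abs_self _))

lemma extremal_bound {n m : ℕ} (f : Fin m → E n → E n) (hf : ∀ i, ContDiff ℝ (⊤ : ℕ∞) (f i))
    (xbar p₀ : E n) :
    ∃ B : ℝ, 0 ≤ B ∧ ∀ ε : ℝ, 0 < ε → ε * (B + 1) ≤ 1 / 2 → ∀ x p : ℝ → E n,
      IsNormalExtremalOn f x p (Icc 0 ε) → x 0 = xbar → p 0 ∈ Metric.ball p₀ (1/2) →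
      (∀ t ∈ Icc 0 ε, x t ∈ Metric.ball xbar 1 ∧ p t ∈ Metric.ball p₀ 1) ∧
      ∃ K : NNReal, LipschitzOnWith K (fun t => (x t, p t)) (Icc 0 ε) := by
  let F : E n × E n → E n × E n := fun w => (∑ i, ⟪w.2, f i w.1⟫ • f i w.1,
    -∑ i, ⟪w.2, f i w.1⟫ • (ContinuousLinearMap.adjoint (fderiv ℝ (f i) w.1)) w.2)
  have hF : Continuous F := by
    have h1 : ∀ i, Continuous (fun w : E n × E n => f i w.1) := fun i =>
      (hf i).continuous.comp continuous_fst
    have h2 : ∀ i, Continuous (fun w : E n × E n => ⟪w.2, f i w.1⟫) := fun i =>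
      continuous_snd.inner (h1 i)
    have h3 : ∀ i, Continuous (fun w : E n × E n =>
        (ContinuousLinearMap.adjoint (fderiv ℝ (f i) w.1)) w.2) := fun i =>
      (((ContinuousLinearMap.adjoint (𝕜 := ℝ) (E := E n) (F := E n)).continuous.comp
        (((hf i).continuous_fderiv (by simp)).comp continuous_fst))).clm_apply continuous_snd
    exact (continuous_finsetSum _ fun i _ => (h2 i).smul (h1 i)).prodMk
      (continuous_finsetSum _ fun i _ => (h2 i).smul (h3 i)).neg
  obtain ⟨B, hB⟩ := (isCompact_closedBall (xbar, p₀) (1:ℝ)).exists_bound_of_continuousOn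
    hF.continuousOn
  have hB0 : 0 ≤ B := (norm_nonneg _).trans (hB (xbar, p₀) (by simp))
  refine ⟨B, hB0, fun ε hε hεB x p hxp hx0 hp0 => ?_⟩
  set w : ℝ → E n × E n := fun t => (x t, p t) with hw
  have hwd : ∀ t ∈ Icc 0 ε, HasDerivWithinAt w (F (w t)) (Icc 0 ε) t := fun t ht =>
    (hxp t ht).1.prodMk (hxp t ht).2
  have hw0 : ‖w 0 - (xbar, p₀)‖ < 1 / 2 := by
    simp only [hw, hx0, Prod.mk_sub_mk, sub_self, Prod.norm_mk, norm_zero]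
    refine max_lt (by norm_num) ?_
    rwa [← dist_eq_norm]
  have hstay : ∀ t ∈ Icc 0 ε, ‖w t - w 0‖ ≤ (B + 1) * t → ‖w t - (xbar, p₀)‖ < 1 := by
    intro t ht h
    have : (B + 1) * t ≤ 1 / 2 := by nlinarith [ht.2]
    calc _ ≤ ‖w t - w 0‖ + ‖w 0 - (xbar, p₀)‖ := norm_sub_le_norm_sub_add_norm_sub _ _ _
      _ < 1 := by linarith
  have hmain : ∀ t ∈ Icc 0 ε, ‖w t - w 0‖ ≤ (B + 1) * t := by
    intro t ht
    refine image_norm_le_of_norm_deriv_right_lt_deriv_boundary' (f := fun t => w t - w 0)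
      (f' := fun t => F (w t)) (a := 0) (b := ε) (B := fun t => (B + 1) * t)
      (B' := fun _ => B + 1) ?_ ?_ (by simp) (by fun_prop) ?_ ?_ ht
    · exact fun t ht => ((hwd t ht).sub_const _).continuousWithinAt
    · intro t ht
      exact ((hwd t ⟨ht.1, ht.2.le⟩).sub_const _).mono_of_mem_nhdsWithin
        (Icc_mem_nhdsGE_of_mem ht)
    · intro t _
      simpa using ((hasDerivAt_id t).const_mul (B + 1)).hasDerivWithinAt
    · intro t ht h
      have := hB (w t) (by
        rw [mem_closedBall_iff_norm]
        exact (hstay t ⟨ht.1, ht.2.le⟩ h.le).le)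
      linarith
  have hin : ∀ t ∈ Icc 0 ε, ‖w t - (xbar, p₀)‖ < 1 := fun t ht => hstay t ht (hmain t ht)
  refine ⟨fun t ht => ?_, Real.toNNReal B, ?_⟩
  · have := hin t ht
    simp only [hw, Prod.mk_sub_mk, Prod.norm_mk, max_lt_iff] at this
    rwa [mem_ball_iff_norm, mem_ball_iff_norm]
  · refine (convex_Icc 0 ε).lipschitzOnWith_of_nnnorm_hasDerivWithin_le hwd fun t ht => ?_
    rw [← NNReal.coe_le_coe, coe_nnnorm, Real.coe_toNNReal _ hB0]
    exact hB _ (by rw [mem_closedBall_iff_norm]; exact (hin t ht).le)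

lemma pointwise_ineq {n m : ℕ} (f : Fin m → E n → E n) (hf : ∀ i, ContDiff ℝ (⊤ : ℕ∞) (f i))
    (xbar p₀ : E n) (C : ℝ)
    (hC : ∀ a ∈ Metric.closedBall (xbar, p₀) (3:ℝ), ∀ b ∈ Metric.closedBall (xbar, p₀) (3:ℝ),
      Ham f b.1 b.2 ≤ Ham f a.1 a.2 +
        fderiv ℝ (fun w : E n × E n => Ham f w.1 w.2) a (b - a) + C * ‖b - a‖ ^ 2)
    (x p y : E n) (hx : x ∈ Metric.ball xbar 1) (hp : p ∈ Metric.ball p₀ 1)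
    (hy : y ∈ Metric.ball xbar 1) (u : Fin m → ℝ) (M : ℝ) (hM : M = 2 * C + 1) (t : ℝ)
    (hk0 : 0 ≤ M * t) (hk1 : M * t ≤ 1) :
    (⟪p, (∑ i, u i • f i y) - ∑ i, ⟪p, f i x⟫ • f i x⟫ +
      ⟪-∑ i, ⟪p, f i x⟫ • (ContinuousLinearMap.adjoint (fderiv ℝ (f i) x)) p, y - x⟫) -
      (M / 2 * ⟪y - x, y - x⟫ + M * t / 2 *
        (⟪y - x, (∑ i, u i • f i y) - ∑ i, ⟪p, f i x⟫ • f i x⟫ +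
         ⟪(∑ i, u i • f i y) - ∑ i, ⟪p, f i x⟫ • f i x, y - x⟫)) ≤
    (1/2 : ℝ) * ∑ i, (u i) ^ 2 - (1/2 : ℝ) * ∑ i, ⟪p, f i x⟫ ^ 2 := by
  obtain ⟨z, rfl⟩ : ∃ z, y = x + z := ⟨y - x, by simp⟩
  rw [add_sub_cancel_left]
  generalize hk : M * t = k at *
  rw [mem_ball_iff_norm] at hx hp hy
  have hz : ‖z‖ ≤ 2 := by
    have : z = (x + z - xbar) - (x - xbar) := by abel
    rw [this]; exact (norm_sub_le _ _).trans (by linarith)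
  have hkz : ‖k • z‖ ≤ ‖z‖ := by
    rw [norm_smul, Real.norm_of_nonneg hk0]; exact mul_le_of_le_one_left (norm_nonneg _) hk1
  have hT := hC (x, p) (by
      rw [mem_closedBall_iff_norm, Prod.mk_sub_mk, Prod.norm_mk]
      exact max_le (by linarith) (by linarith)) (x + z, p - k • z) (by
      rw [mem_closedBall_iff_norm, Prod.mk_sub_mk, Prod.norm_mk]
      refine max_le (by linarith) ?_
      have : p - k • z - p₀ = (p - p₀) - k • z := by abel
      rw [this]; exact (norm_sub_le _ _).trans (by linarith))
  rw [Prod.mk_sub_mk, add_sub_cancel_left, sub_sub_cancel_left, ham_fderiv f hf] at hT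
  have hn : ‖(z, -(k • z))‖ = ‖z‖ := by
    rw [Prod.norm_mk, norm_neg]; exact max_eq_left hkz
  rw [hn] at hT
  have hY : ∑ i, u i * ⟪p - k • z, f i (x + z)⟫ ≤
      (1/2 : ℝ) * ∑ i, (u i)^2 + Ham f (x + z) (p - k • z) := by
    unfold Ham
    rw [← mul_add, ← Finset.sum_add_distrib, Finset.mul_sum]
    refine Finset.sum_le_sum fun i _ => ?_
    nlinarith [sq_nonneg (u i - ⟪p - k • z, f i (x + z)⟫)]
  have e1 : ⟪p, (∑ i, u i • f i (x + z)) - ∑ i, ⟪p, f i x⟫ • f i x⟫ =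
      ∑ i, u i * ⟪p, f i (x + z)⟫ - ∑ i, ⟪p, f i x⟫ ^ 2 := by
    simp only [inner_sub_right, inner_sum, inner_smul_right, sq]
  have e2 : ⟪z, (∑ i, u i • f i (x + z)) - ∑ i, ⟪p, f i x⟫ • f i x⟫ =
      ∑ i, u i * ⟪z, f i (x + z)⟫ - ∑ i, ⟪p, f i x⟫ * ⟪z, f i x⟫ := by
    simp only [inner_sub_right, inner_sum, inner_smul_right]
  have e3 : ⟪-∑ i, ⟪p, f i x⟫ • (ContinuousLinearMap.adjoint (fderiv ℝ (f i) x)) p, z⟫ =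
      -∑ i, ⟪p, f i x⟫ * ⟪p, fderiv ℝ (f i) x z⟫ := by
    simp only [inner_neg_left, sum_inner, inner_smul_left, ContinuousLinearMap.adjoint_inner_left]
    simp
  have e4 : ∑ i, u i * ⟪p - k • z, f i (x + z)⟫ =
      ∑ i, u i * ⟪p, f i (x + z)⟫ - k * ∑ i, u i * ⟪z, f i (x + z)⟫ := by
    simp only [inner_sub_left, real_inner_smul_left, mul_sub, Finset.sum_sub_distrib,
      Finset.mul_sum]
    congr 1
    exact Finset.sum_congr rfl fun i _ => by ring
  have e5 : ∑ i, ⟪p, f i x⟫ * (⟪-(k • z), f i x⟫ + ⟪p, fderiv ℝ (f i) x z⟫) =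
      - (k * ∑ i, ⟪p, f i x⟫ * ⟪z, f i x⟫) + ∑ i, ⟪p, f i x⟫ * ⟪p, fderiv ℝ (f i) x z⟫ := by
    simp only [inner_neg_left, real_inner_smul_left, mul_add, Finset.sum_add_distrib,
      Finset.mul_sum, ← Finset.sum_neg_distrib]
    congr 1
    exact Finset.sum_congr rfl fun i _ => by ring
  have e6 : Ham f x p = (1/2 : ℝ) * ∑ i, ⟪p, f i x⟫ ^ 2 := rfl
  rw [real_inner_comm z ((∑ i, u i • f i (x + z)) - ∑ i, ⟪p, f i x⟫ • f i x), e1, e2, e3,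
    real_inner_self_eq_norm_sq]
  simp only at hT
  rw [e5, e6] at hT
  rw [e4] at hY
  have hMz : M / 2 * ‖z‖ ^ 2 = C * ‖z‖ ^ 2 + 1 / 2 * ‖z‖ ^ 2 := by rw [hM]; ring
  nlinarith [sq_nonneg ‖z‖]

/-- if `H(x̄, p₀) ≠ 0`, there exist a neighborhood `W` of `p₀`, `ε > 0` and
`ρ > 0` such that every normal extremal on `[0, ε]` starting from `x̄` with `p(0) ∈ W` stays in
`B(x̄, ρ)` and is minimizing among trajectories in `B(x̄, ρ)` from `x̄` reaching `x(ε)` at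
time `ε`. -/
theorem stmt_9 {n m : ℕ} (f : Fin m → E n → E n) (hf : ∀ i, ContDiff ℝ (⊤ : ℕ∞) (f i))
    (xbar p₀ : E n) (hp₀ : Ham f xbar p₀ ≠ 0) :
    ∃ W : Set (E n), IsOpen W ∧ p₀ ∈ W ∧ ∃ ε : ℝ, 0 < ε ∧ ∃ ρ : ℝ, 0 < ρ ∧
      ∀ x p : ℝ → E n, IsNormalExtremalOn f x p (Icc 0 ε) → x 0 = xbar → p 0 ∈ W →
        (∀ t ∈ Icc (0:ℝ) ε, x t ∈ Metric.ball xbar ρ) ∧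
        ∀ u : ℝ → Fin m → ℝ, IsBoundedControl ε u →
          ∀ y : ℝ → E n, IsTrajectoryOn f u ε y → y 0 = xbar →
            (∀ t ∈ Icc (0:ℝ) ε, y t ∈ Metric.ball xbar ρ) → y ε = x ε →
            (∫ t in (0:ℝ)..ε, ∑ i, ⟪p t, f i (x t)⟫ ^ 2) ≤
              ∫ t in (0:ℝ)..ε, ∑ i, (u t i) ^ 2 := by
  obtain ⟨B, hB0, hB⟩ := extremal_bound f hf xbar p₀
  obtain ⟨C, hC0, hC⟩ := taylor_ball (fun w : E n × E n => Ham f w.1 w.2) (ham_contDiff f hf)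
    (xbar, p₀) 3
  obtain ⟨ε, hε, hεM, hεB⟩ : ∃ ε : ℝ, 0 < ε ∧ (2 * C + 1) * ε ≤ 1 ∧ ε * (B + 1) ≤ 1 / 2 := by
    refine ⟨min (1 / (2 * C + 1)) (1 / (2 * (B + 1))), by positivity, ?_, ?_⟩
    · calc _ ≤ (2 * C + 1) * (1 / (2 * C + 1)) := by gcongr; exact min_le_left _ _
        _ = 1 := by field_simp
        _ ≤ 1 := le_rfl
    · calc _ ≤ (1 / (2 * (B + 1))) * (B + 1) := by gcongr; exact min_le_right _ _
        _ = 1 / 2 := by field_simp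
        _ ≤ 1 / 2 := le_rfl
  refine ⟨Metric.ball p₀ (1/2), Metric.isOpen_ball, by simp, ε, hε, 1, one_pos, ?_⟩
  intro x p hxp hx0 hp0
  obtain ⟨hin, Kw, hKw⟩ := hB ε hε hεB x p hxp hx0 hp0
  refine ⟨fun t ht => (hin t ht).1, ?_⟩
  intro u hu y hy hy0 hyin hyε
  obtain ⟨⟨Ky, hKy⟩, hyd, hui⟩ := traj_reg f hf u ε hε.le hu y hy
  set M : ℝ := 2 * C + 1 with hM
  let Φ : ℝ × (E n × E n) × E n → ℝ := fun c =>
    ⟪c.2.1.2, c.2.2 - c.2.1.1⟫ - M * c.1 / 2 * ⟪c.2.2 - c.2.1.1, c.2.2 - c.2.1.1⟫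
  have hΦ : ContDiff ℝ 1 Φ := by
    have h1 : ContDiff ℝ 1 (fun c : ℝ × (E n × E n) × E n => c.2.2 - c.2.1.1) := by fun_prop
    have h2 : ContDiff ℝ 1 (fun c : ℝ × (E n × E n) × E n => c.2.1.2) := by fun_prop
    have h3 : ContDiff ℝ 1 (fun c : ℝ × (E n × E n) × E n => M * c.1 / 2) := by fun_prop
    exact (h2.inner ℝ h1).sub (h3.mul (h1.inner ℝ h1))
  let φ : ℝ → ℝ := fun t => ⟪p t, y t - x t⟫ - M * t / 2 * ⟪y t - x t, y t - x t⟫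
  have hac : AbsolutelyContinuousOnInterval φ 0 ε :=
    ac_of_lipschitz Φ hΦ (fun t => (t, (x t, p t), y t)) ε hε.le _
      ((LipschitzWith.id.lipschitzOnWith (s := Icc 0 ε)).prodMk (hKw.prodMk hKy))
  have hint := hac.integral_deriv_eq_sub
  have hφ0 : φ 0 = 0 := by simp [φ, hx0, hy0]
  have hφε : φ ε = 0 := by simp [φ, hyε]
  rw [hφ0, hφε, sub_zero] at hint
  have hxc : ContinuousOn x (Icc 0 ε) := fun t ht => (hxp t ht).1.continuousWithinAt
  have hpc : ContinuousOn p (Icc 0 ε) := fun t ht => (hxp t ht).2.continuousWithinAt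
  have hvi : IntervalIntegrable (fun t => ∑ i, ⟪p t, f i (x t)⟫ ^ 2) volume 0 ε := by
    refine ContinuousOn.intervalIntegrable ?_
    rw [uIcc_of_le hε.le]
    exact continuousOn_finset_sum _ fun i _ =>
      (hpc.inner ((hf i).continuous.comp_continuousOn hxc)).pow 2
  have hle : ∫ t in (0:ℝ)..ε, deriv φ t ≤ ∫ t in (0:ℝ)..ε,
      ((1/2 : ℝ) * ∑ i, (u t i) ^ 2 - (1/2 : ℝ) * ∑ i, ⟪p t, f i (x t)⟫ ^ 2) := by
    refine intervalIntegral.integral_mono_ae_restrict hε.le hac.intervalIntegrable_deriv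
      ((hui.const_mul _).sub (hvi.const_mul _)) ?_
    rw [restrict_Ioo_eq_restrict_Icc.symm]
    refine (ae_restrict_iff' measurableSet_Ioo).2 ?_
    filter_upwards [hyd] with t hyd' ht
    have htc : t ∈ Icc 0 ε := Ioo_subset_Icc_self ht
    have hnh := Icc_mem_nhds ht.1 ht.2
    have dy := hyd' ht
    have dx := (hxp t htc).1.hasDerivAt hnh
    have dp := (hxp t htc).2.hasDerivAt hnh
    have dz := dy.sub dx
    have dM : HasDerivAt (fun t : ℝ => M * t / 2) (M / 2) t := by
      simpa using ((hasDerivAt_id t).const_mul M).div_const 2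
    have dφ := (dp.inner ℝ dz).sub (dM.mul (dz.inner ℝ dz))
    have dφ' : HasDerivAt φ _ t := dφ
    rw [dφ'.deriv]
    obtain ⟨hxt, hpt⟩ := hin t htc
    have hyt := hyin t htc
    have hk0 : 0 ≤ M * t := mul_nonneg (by positivity) htc.1
    have hk1 : M * t ≤ 1 := le_trans (by gcongr; exact htc.2) hεM
    exact pointwise_ineq f hf xbar p₀ C hC (x t) (p t) (y t) hxt hpt hyt (u t) M hM t hk0 hk1
  rw [hint, intervalIntegral.integral_sub (hui.const_mul _) (hvi.const_mul _),
    intervalIntegral.integral_const_mul, intervalIntegral.integral_const_mul] at hle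
  linarith
end
end

section
/- Fix smooth vector fields f₁, …, f_m : ℝⁿ → ℝⁿ and x̄ ∈ ℝⁿ, and let V be the associated value function. Assume that V(x) is finite for every x ∈ ℝⁿ, that V is continuous on ℝⁿ, and that for every x ∈ ℝⁿ \ {x̄} the infimum defining V(x) is attained by some control. Then V is a viscosity solution on ℝⁿ \ {x̄} of the Hamilton–Jacobi equation −(1/2)·V(x) + H(x, (1/2)·dV(x)) = 0, where H(x,p) := (1/2)·Σᵢ ⟨p, fᵢ(x)⟩². -/
open scoped RealInnerProductSpace ENNReal Gradient
open Set Filter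

noncomputable section

/-- `u` is a viscosity subsolution of `F(x, du(x), u(x)) = 0` on the open set `U`. -/
def ViscositySubsolutionOn {n : ℕ} (U : Set (E n)) (F : E n → E n → ℝ → ℝ)
    (u : E n → ℝ) : Prop :=
  ∀ φ : E n → ℝ, ContDiffOn ℝ 1 φ U → (∀ x ∈ U, u x ≤ φ x) →
    ∀ x₀ ∈ U, φ x₀ = u x₀ → F x₀ (∇ φ x₀) (u x₀) ≤ 0

/-- `u` is a viscosity supersolution of `F(x, du(x), u(x)) = 0` on the open set `U`. -/
def ViscositySupersolutionOn {n : ℕ} (U : Set (E n)) (F : E n → E n → ℝ → ℝ)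
    (u : E n → ℝ) : Prop :=
  ∀ ψ : E n → ℝ, ContDiffOn ℝ 1 ψ U → (∀ x ∈ U, ψ x ≤ u x) →
    ∀ x₀ ∈ U, ψ x₀ = u x₀ → 0 ≤ F x₀ (∇ ψ x₀) (u x₀)

lemma traj_integrable {n m : ℕ} {f : Fin m → E n → E n} (hf : ∀ i, Continuous (f i))
    {T : ℝ} {u : ℝ → Fin m → ℝ} {y : ℝ → E n} (hu : IsBoundedControl T u)
    (hy : ContinuousOn y (Icc 0 T)) :
    MeasureTheory.IntegrableOn (fun s => ∑ i, u s i • f i (y s)) (Icc 0 T) := by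
  obtain ⟨hum, K, hK⟩ := hu
  refine MeasureTheory.integrable_finsetSum _ fun i _ => ?_
  have h1 : MeasureTheory.IntegrableOn (fun s => u s i) (Icc 0 T) := by
    refine MeasureTheory.Measure.integrableOn_of_bounded (M := K) (by simp)
      ((measurable_pi_apply i).comp hum).aestronglyMeasurable ?_
    filter_upwards [MeasureTheory.ae_restrict_mem measurableSet_Icc] with t ht
    exact (norm_le_pi_norm (u t) i).trans (hK t ht)
  exact h1.smul_continuousOn ((hf i).comp_continuousOn hy) isCompact_Icc

lemma cost_integrable {m : ℕ} {T : ℝ} {u : ℝ → Fin m → ℝ} (hu : IsBoundedControl T u) :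
    MeasureTheory.IntegrableOn (fun s => ∑ i, (u s i) ^ 2) (Icc 0 T) := by
  obtain ⟨hum, K, hK⟩ := hu
  refine MeasureTheory.integrable_finsetSum _ fun i _ => ?_
  refine MeasureTheory.Measure.integrableOn_of_bounded (M := K ^ 2) (by simp)
    (((measurable_pi_apply i).comp hum).pow_const 2).aestronglyMeasurable ?_
  filter_upwards [MeasureTheory.ae_restrict_mem measurableSet_Icc] with t ht
  rw [norm_pow]
  exact pow_le_pow_left₀ (norm_nonneg _) ((norm_le_pi_norm (u t) i).trans (hK t ht)) 2

lemma ii_sub {F : Type*} [NormedAddCommGroup F] {g : ℝ → F} {T a b : ℝ}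
    (h : MeasureTheory.IntegrableOn g (Icc 0 T)) (ha : 0 ≤ a) (hab : a ≤ b) (hb : b ≤ T) :
    IntervalIntegrable g MeasureTheory.volume a b := by
  rw [intervalIntegrable_iff_integrableOn_Icc_of_le hab]
  exact h.mono_set (Icc_subset_Icc ha hb)

/-- Reparametrization: a trajectory on `[0,T]` gives an upper bound for the value function. -/
lemma value_le {n m : ℕ} {f : Fin m → E n → E n} {xbar : E n} {T : ℝ} (hT : 0 < T)
    {u : ℝ → Fin m → ℝ} {y : ℝ → E n} (hu : IsBoundedControl T u)
    (hy : IsTrajectoryOn f u T y) (h0 : y 0 = xbar) :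
    (valueFun f xbar (y T)).toReal ≤ T * ∫ t in (0:ℝ)..T, ∑ i, (u t i) ^ 2 := by
  have hmaps : ∀ t ∈ Icc (0:ℝ) 1, T * t ∈ Icc (0:ℝ) T := fun t ht =>
    ⟨mul_nonneg hT.le ht.1, by nlinarith [ht.2]⟩
  have hcost : ∫ t in (0:ℝ)..1, ∑ i, (T * u (T * t) i) ^ 2
      = T * ∫ t in (0:ℝ)..T, ∑ i, (u t i) ^ 2 := by
    have h1 := intervalIntegral.smul_integral_comp_mul_left (a := 0) (b := 1)
      (fun t => ∑ i, (u t i) ^ 2) T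
    simp only [mul_zero, mul_one] at h1
    rw [← h1, smul_eq_mul, ← intervalIntegral.integral_const_mul,
      ← intervalIntegral.integral_const_mul]
    congr 1
    ext t
    rw [Finset.mul_sum, Finset.mul_sum]
    refine Finset.sum_congr rfl fun i _ => by ring
  have hle : valueFun f xbar (y T)
      ≤ ENNReal.ofReal (T * ∫ t in (0:ℝ)..T, ∑ i, (u t i) ^ 2) := by
    refine sInf_le ⟨fun t i => T * u (T * t) i, ⟨?_, ?_⟩, fun t => y (T * t), ⟨?_, ?_⟩, ?_, ?_, ?_⟩
    · have := hu.1
      fun_prop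
    · obtain ⟨K, hK⟩ := hu.2
      refine ⟨T * K, fun t ht => ?_⟩
      change ‖T • u (T * t)‖ ≤ T * K
      rw [norm_smul, Real.norm_of_nonneg hT.le]
      exact mul_le_mul_of_nonneg_left (hK _ (hmaps t ht)) hT.le
    · exact hy.1.comp (by fun_prop) hmaps
    · intro t ht
      have h2 := hy.2 _ (hmaps t ht)
      have h1 := intervalIntegral.smul_integral_comp_mul_left (a := 0) (b := t)
        (fun s => ∑ i, u s i • f i (y s)) T
      simp only [mul_zero] at h1
      simp only [mul_zero]
      rw [h2, ← h1, ← intervalIntegral.integral_smul]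
      simp only [Finset.smul_sum, smul_smul]
    · simpa using h0
    · simp
    · rw [hcost]
  refine ENNReal.toReal_le_of_le_ofReal ?_ hle
  refine mul_nonneg hT.le (intervalIntegral.integral_nonneg hT.le fun t _ => ?_)
  exact Finset.sum_nonneg fun i _ => sq_nonneg _

lemma traj_restrict {n m : ℕ} {f : Fin m → E n → E n} {T S : ℝ} (hS : S ≤ T)
    {u : ℝ → Fin m → ℝ} {y : ℝ → E n}
    (hy : IsTrajectoryOn f u T y) : IsTrajectoryOn f u S y :=
  ⟨hy.1.mono (Icc_subset_Icc le_rfl hS), fun t ht => hy.2 t ⟨ht.1, ht.2.trans hS⟩⟩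

lemma control_restrict {m : ℕ} {T S : ℝ} (hS : S ≤ T) {u : ℝ → Fin m → ℝ}
    (hu : IsBoundedControl T u) : IsBoundedControl S u :=
  ⟨hu.1, hu.2.imp fun _ hK t ht => hK t ⟨ht.1, ht.2.trans hS⟩⟩

/-- Concatenation with a constant control. -/
lemma value_concat {n m : ℕ} {f : Fin m → E n → E n} (hf : ∀ i, Continuous (f i))
    {xbar : E n} (hfin : ∀ x : E n, valueFun f xbar x ≠ ⊤)
    (v : Fin m → ℝ) {z : ℝ → E n} {ε : ℝ} (hε : 0 < ε)
    (hz : ∀ t ∈ Icc (-ε) 0, HasDerivAt z (∑ i, v i • f i (z t)) t) :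
    (valueFun f xbar (z 0)).toReal
      ≤ (1 + ε) * ((valueFun f xbar (z (-ε))).toReal + ε * ∑ i, v i ^ 2) := by
  have key : ∀ c, (valueFun f xbar (z (-ε))).toReal < c →
      (valueFun f xbar (z 0)).toReal / (1 + ε) - ε * ∑ i, v i ^ 2 ≤ c := by
    intro c hc
    have hc' : valueFun f xbar (z (-ε)) < ENNReal.ofReal c :=
      (ENNReal.lt_ofReal_iff_toReal_lt (hfin _)).2 hc
    obtain ⟨c', ⟨u, hu, y, hy, hy0, hy1, rfl⟩, hlt⟩ := sInf_lt_iff.1 hc'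
    have hcost : ∫ t in (0:ℝ)..1, ∑ i, (u t i) ^ 2 < c :=
      (ENNReal.ofReal_lt_ofReal_iff' .. |>.1 hlt).1
    set w : ℝ → Fin m → ℝ := fun t => if t ≤ 1 then u t else v with hw
    set q : ℝ → E n := fun t => if t ≤ 1 then y t else z (t - (1 + ε)) with hq
    have hzc : ContinuousOn z (Icc (-ε) 0) := fun t ht => (hz t ht).continuousAt.continuousWithinAt
    have hmaps : ∀ t ∈ Icc (1:ℝ) (1 + ε), t - (1 + ε) ∈ Icc (-ε) 0 := fun t ht =>
      ⟨by linarith [ht.1], by linarith [ht.2]⟩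
    have hwb : IsBoundedControl (1 + ε) w := by
      refine ⟨Measurable.ite measurableSet_Iic hu.1 measurable_const, ?_⟩
      obtain ⟨K, hK⟩ := hu.2
      refine ⟨max K ‖v‖, fun t ht => ?_⟩
      by_cases h : t ≤ 1
      · simp only [hw, h, if_true]
        exact (hK t ⟨ht.1, h⟩).trans (le_max_left _ _)
      · simp only [hw, h, if_false]
        exact le_max_right _ _
    have hq2 : ∀ t ∈ Icc (1:ℝ) (1 + ε), q t = z (t - (1 + ε)) := by
      intro t ht
      by_cases h : t ≤ 1
      · have : t = 1 := le_antisymm h ht.1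
        subst this
        simp only [hq, le_refl, if_true, hy1]
        congr 1
        ring
      · simp only [hq, h, if_false]
    have hqc : ContinuousOn q (Icc 0 (1 + ε)) := by
      have e : Icc (0:ℝ) (1 + ε) = Icc 0 1 ∪ Icc 1 (1 + ε) :=
        (Icc_union_Icc_eq_Icc (by norm_num) (by linarith)).symm
      rw [e]
      refine ContinuousOn.union_of_isClosed ?_ ?_ isClosed_Icc isClosed_Icc
      · refine hy.1.congr fun t ht => by simp only [hq, ht.2, if_true]
      · exact (hzc.comp (f := fun t => t - (1 + ε)) (by fun_prop) hmaps).congr hq2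
    have hint := traj_integrable hf hwb hqc
    have hint2 := cost_integrable hwb
    have htraj1 : ∀ t ∈ Icc (0:ℝ) 1, q t = q 0 + ∫ s in (0:ℝ)..t, ∑ i, w s i • f i (q s) := by
      intro t ht
      have e1 : q t = y t := by simp only [hq, ht.2, if_true]
      have e2 : q 0 = y 0 := by simp [hq]
      rw [e1, e2, hy.2 t ht]
      congr 1
      refine intervalIntegral.integral_congr fun s hs => ?_
      rw [uIcc_of_le ht.1] at hs
      have : s ≤ 1 := hs.2.trans ht.2
      simp only [hw, hq, this, if_true]
    have htraj : IsTrajectoryOn f w (1 + ε) q := by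
      refine ⟨hqc, fun t ht => ?_⟩
      by_cases h : t ≤ 1
      · exact htraj1 t ⟨ht.1, h⟩
      · have h : 1 < t := not_le.1 h
        rw [← intervalIntegral.integral_add_adjacent_intervals (b := 1)
          (ii_sub hint le_rfl zero_le_one (by linarith))
          (ii_sub hint zero_le_one h.le ht.2), ← add_assoc, ← htraj1 1 (by simp)]
        have e3 : ∫ s in (1:ℝ)..t, ∑ i, w s i • f i (q s)
            = ∫ s in (1:ℝ)..t, ∑ i, v i • f i (z (s - (1 + ε))) := by
          refine intervalIntegral.integral_congr_ae ?_
          refine Eventually.of_forall fun s hs => ?_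
          rw [uIoc_of_le h.le] at hs
          simp only [hw, hq, not_le.2 hs.1, if_false]
        rw [e3, intervalIntegral.integral_comp_sub_right (fun s => ∑ i, v i • f i (z s)),
          intervalIntegral.integral_eq_sub_of_hasDerivAt (f := z)]
        · rw [hq2 t ⟨h.le, ht.2⟩, hq2 1 ⟨le_rfl, by linarith⟩]
          abel
        · intro s hs
          rw [uIcc_of_le (by linarith)] at hs
          exact hz s ⟨by linarith [hs.1], by linarith [hs.2, ht.2]⟩
        · refine ContinuousOn.intervalIntegrable ?_
          rw [uIcc_of_le (by linarith)]
          refine continuousOn_finsetSum _ fun i _ => ?_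
          refine ContinuousOn.const_smul ((hf i).comp_continuousOn (hzc.mono ?_)) (v i)
          intro s hs
          exact ⟨by linarith [hs.1], by linarith [hs.2, ht.2]⟩
    have hq0 : q 0 = xbar := by simp [hq, hy0]
    have hqT : q (1 + ε) = z 0 := by
      rw [hq2 _ ⟨by linarith, le_rfl⟩, sub_self]
    have hv := value_le (by linarith : (0:ℝ) < 1 + ε) hwb htraj hq0
    rw [hqT] at hv
    have hsplit : ∫ t in (0:ℝ)..(1 + ε), ∑ i, (w t i) ^ 2
        = (∫ t in (0:ℝ)..1, ∑ i, (u t i) ^ 2) + ε * ∑ i, v i ^ 2 := by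
      rw [← intervalIntegral.integral_add_adjacent_intervals (b := 1)
          (ii_sub hint2 le_rfl zero_le_one (by linarith))
          (ii_sub hint2 zero_le_one (by linarith) le_rfl)]
      congr 1
      · refine intervalIntegral.integral_congr fun s hs => ?_
        rw [uIcc_of_le zero_le_one] at hs
        simp only [hw, hs.2, if_true]
      · have : ∫ t in (1:ℝ)..(1 + ε), ∑ i, (w t i) ^ 2 = ∫ t in (1:ℝ)..(1 + ε), ∑ i, (v i) ^ 2 := by
          refine intervalIntegral.integral_congr_ae ?_
          refine Eventually.of_forall fun s hs => ?_
          rw [uIoc_of_le (by linarith)] at hs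
          simp only [hw, not_le.2 hs.1, if_false]
        rw [this, intervalIntegral.integral_const]
        simp
    rw [hsplit] at hv
    have : (valueFun f xbar (z 0)).toReal / (1 + ε)
        ≤ (∫ t in (0:ℝ)..1, ∑ i, (u t i) ^ 2) + ε * ∑ i, v i ^ 2 := by
      rw [div_le_iff₀ (by linarith)]
      linarith
    linarith
  have h := le_of_forall_gt_imp_ge_of_dense key
  have h' : (valueFun f xbar (z 0)).toReal / (1 + ε)
      ≤ (valueFun f xbar (z (-ε))).toReal + ε * ∑ i, v i ^ 2 := by linarith
  rw [div_le_iff₀ (by linarith)] at h'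
  linarith

lemma ham_half {n m : ℕ} (f : Fin m → E n → E n) (x p : E n) :
    Ham f x ((1 / 2 : ℝ) • p) = (1 / 8) * ∑ i, ⟪p, f i x⟫ ^ 2 := by
  unfold Ham
  rw [Finset.mul_sum, Finset.mul_sum]
  refine Finset.sum_congr rfl fun i _ => ?_
  rw [real_inner_smul_left]
  ring

lemma sub_part {n m : ℕ} {f : Fin m → E n → E n} (hf : ∀ i, ContDiff ℝ (⊤ : ℕ∞) (f i))
    {xbar : E n} (hfin : ∀ x : E n, valueFun f xbar x ≠ ⊤)
    {φ : E n → ℝ} {x₀ p : E n} (hφ : HasGradientAt φ p x₀)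
    (hle : ∀ᶠ x in nhds x₀, (valueFun f xbar x).toReal ≤ φ x)
    (heq : φ x₀ = (valueFun f xbar x₀).toReal) :
    (∑ i, ⟪p, f i x₀⟫ ^ 2) / 4 ≤ φ x₀ := by
  set v : Fin m → ℝ := fun i => ⟪p, f i x₀⟫ / 2 with hv
  have hF : ContDiff ℝ 1 (fun x => ∑ i, v i • f i x) := by
    refine ContDiff.sum fun i _ => ContDiff.const_smul (v i) ((hf i).of_le ?_)
    exact_mod_cast le_top
  obtain ⟨r, hr, ε, hε, H⟩ :=
    (hF.contDiffAt (x := x₀)).exists_forall_mem_closedBall_exists_eq_forall_mem_Ioo_hasDerivAt 0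
  obtain ⟨z, hz0, hz⟩ := H x₀ (Metric.mem_closedBall_self hr.le)
  have hzd := hz 0 ⟨by linarith, by linarith⟩
  have hφz : HasDerivAt (fun s => φ (z s)) (⟪p, ∑ i, v i • f i x₀⟫) 0 := by
    have h1 : HasFDerivAt φ (InnerProductSpace.toDual ℝ (E n) p) (z 0) := by
      rw [hz0]; exact hφ.hasFDerivAt
    have := h1.comp_hasDerivAt 0 hzd
    rw [hz0] at this
    exact this
  set N := ∑ i, v i ^ 2 with hN
  have hk : HasDerivAt (fun s => (1 - s) * (φ (z s) - s * N))
      (-(φ x₀) + (⟪p, ∑ i, v i • f i x₀⟫ - N)) 0 := by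
    have h1 := ((hasDerivAt_id (0:ℝ)).const_sub 1).mul
      (hφz.sub ((hasDerivAt_id (0:ℝ)).mul_const N))
    refine (h1.congr_deriv ?_)
    simp [hz0]
  have hev : ∀ᶠ s in nhdsWithin (0:ℝ) (Iio 0), φ x₀ ≤ (1 - s) * (φ (z s) - s * N) := by
    have h1 : ∀ᶠ s in nhdsWithin (0:ℝ) (Iio 0), (valueFun f xbar (z s)).toReal ≤ φ (z s) := by
      have : Tendsto z (nhds 0) (nhds x₀) := by
        have := hzd.continuousAt.tendsto
        rwa [hz0] at this
      exact (this.eventually hle).filter_mono nhdsWithin_le_nhds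
    have h2 : ∀ᶠ s in nhdsWithin (0:ℝ) (Iio 0), -ε < s :=
      (eventually_gt_nhds (by linarith)).filter_mono nhdsWithin_le_nhds
    filter_upwards [h1, h2, self_mem_nhdsWithin] with s hs1 hs2 hs3
    have hs3 : s < 0 := hs3
    have := value_concat (fun i => (hf i).continuous) hfin v (ε := -s) (z := z) (by linarith)
      (fun t ht => hz t ⟨by linarith [ht.1], by linarith [ht.2]⟩)
    rw [hz0, ← heq, neg_neg] at this
    refine this.trans ?_
    have : (1 + -s) * ((valueFun f xbar (z s)).toReal + -s * N) ≤ (1 + -s) * (φ (z s) + -s * N) :=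
      mul_le_mul_of_nonneg_left (by linarith) (by linarith)
    refine this.trans (le_of_eq (by ring))
  have hlim : -(φ x₀) + (⟪p, ∑ i, v i • f i x₀⟫ - N) ≤ 0 := by
    refine le_of_tendsto (hasDerivAt_iff_tendsto_slope_left_right.1 hk).1 ?_
    filter_upwards [hev, self_mem_nhdsWithin] with s hs hs3
    have hs3 : s < 0 := hs3
    rw [slope_def_field]
    refine div_nonpos_of_nonneg_of_nonpos ?_ (by linarith)
    simp only [hz0, sub_zero, one_mul, zero_mul]
    linarith
  have e1 : ⟪p, ∑ i, v i • f i x₀⟫ = (∑ i, ⟪p, f i x₀⟫ ^ 2) / 2 := by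
    rw [inner_sum, Finset.sum_div]
    refine Finset.sum_congr rfl fun i _ => ?_
    rw [real_inner_smul_right]
    simp only [hv]
    ring
  have e2 : N = (∑ i, ⟪p, f i x₀⟫ ^ 2) / 4 := by
    rw [hN, Finset.sum_div]
    refine Finset.sum_congr rfl fun i _ => ?_
    simp only [hv]
    ring
  rw [e1, e2] at hlim
  linarith

lemma super_part {n m : ℕ} {f : Fin m → E n → E n} (hf : ∀ i, Continuous (f i))
    {xbar : E n} {ψ : E n → ℝ} {x₀ p : E n} (hψ : HasGradientAt ψ p x₀)
    (hle : ∀ᶠ x in nhds x₀, ψ x ≤ (valueFun f xbar x).toReal)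
    {u : ℝ → Fin m → ℝ} (hu : IsBoundedControl 1 u) {y : ℝ → E n} (hy : IsTrajectoryOn f u 1 y)
    (hy0 : y 0 = xbar) (hy1 : y 1 = x₀)
    (heq : ψ x₀ = ∫ t in (0:ℝ)..1, ∑ i, (u t i) ^ 2) :
    ψ x₀ ≤ (∑ i, ⟪p, f i x₀⟫ ^ 2) / 4 := by
  set G : ℝ → ℝ := fun s => ∑ i, ⟪p, f i (y s)⟫ ^ 2 with hG
  have hint := traj_integrable hf hu hy.1
  have hint2 := cost_integrable hu
  -- bound on the speed
  obtain ⟨C, hC0, hC⟩ : ∃ C : ℝ, 0 < C ∧ ∀ s ∈ Icc (0:ℝ) 1, ‖∑ i, u s i • f i (y s)‖ ≤ C := by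
    obtain ⟨K, hK⟩ := hu.2
    have hc : ContinuousOn (fun s => ∑ i, ‖f i (y s)‖) (Icc 0 1) :=
      continuousOn_finsetSum _ fun i _ => ((hf i).comp_continuousOn hy.1).norm
    obtain ⟨B, hB⟩ := isCompact_Icc.exists_bound_of_continuousOn hc
    refine ⟨|K * B| + 1, by positivity, fun s hs => ?_⟩
    have hK0 : 0 ≤ K := (norm_nonneg _).trans (hK s hs)
    calc ‖∑ i, u s i • f i (y s)‖ ≤ ∑ i, ‖u s i • f i (y s)‖ := norm_sum_le _ _
      _ ≤ ∑ i, K * ‖f i (y s)‖ := by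
        refine Finset.sum_le_sum fun i _ => ?_
        rw [norm_smul]
        exact mul_le_mul_of_nonneg_right ((norm_le_pi_norm (u s) i).trans (hK s hs))
          (norm_nonneg _)
      _ = K * ∑ i, ‖f i (y s)‖ := by rw [Finset.mul_sum]
      _ ≤ K * B := mul_le_mul_of_nonneg_left ((le_abs_self _).trans (hB s hs)) hK0
      _ ≤ |K * B| + 1 := by linarith [le_abs_self (K * B)]
  have hdiff : ∀ T ∈ Icc (0:ℝ) 1, x₀ - y T = ∫ s in T..1, ∑ i, u s i • f i (y s) := by
    intro T hT
    rw [← hy1, hy.2 1 (by simp), hy.2 T hT,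
      ← intervalIntegral.integral_add_adjacent_intervals (ii_sub hint le_rfl hT.1 hT.2)
        (ii_sub hint hT.1 hT.2 le_rfl)]
    abel
  have hyt : Tendsto y (nhdsWithin 1 (Iio 1)) (nhds x₀) := by
    have h1 : ContinuousWithinAt y (Icc 0 1) 1 := hy.1 1 (by simp)
    have h2 : Tendsto y (nhdsWithin 1 (Icc 0 1)) (nhds (y 1)) := h1
    rw [hy1] at h2
    refine h2.mono_left ?_
    rw [← nhdsWithin_Ico_eq_nhdsLT (zero_lt_one : (0:ℝ) < 1)]
    exact nhdsWithin_mono _ Ico_subset_Icc_self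
  have hGc : ContinuousOn G (Icc 0 1) :=
    continuousOn_finsetSum _ fun i _ =>
      (continuousOn_const.inner ((hf i).comp_continuousOn hy.1)).pow 2
  have main : ∀ δ > 0, ψ x₀ ≤ δ + (G 1 + δ) / 4 := by
    intro δ hδ
    have hGe : ∃ a < (1:ℝ), ∀ s, a < s → s ∈ Icc (0:ℝ) 1 → G s ≤ G 1 + δ := by
      have h1 : ∀ᶠ s in nhdsWithin 1 (Icc (0:ℝ) 1), G s < G 1 + δ :=
        (hGc 1 (by simp)).tendsto.eventually (eventually_lt_nhds (by linarith))
      rw [eventually_nhdsWithin_iff, Metric.eventually_nhds_iff] at h1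
      obtain ⟨η, hη, h1⟩ := h1
      refine ⟨1 - η, by linarith, fun s hs hs1 => (h1 ?_ hs1).le⟩
      rw [Real.dist_eq, abs_lt]
      exact ⟨by linarith, by linarith [hs1.2]⟩
    obtain ⟨a, ha, hGa⟩ := hGe
    have hψo : ∀ᶠ x in nhds x₀, ‖ψ x - ψ x₀ - ⟪p, x - x₀⟫‖ ≤ δ / C * ‖x - x₀‖ := by
      have := hψ.hasFDerivAt.isLittleO.def (c := δ / C) (by positivity)
      simpa using this
    have hev : ∀ᶠ T in nhdsWithin (1:ℝ) (Iio 1), ψ x₀ ≤ δ + (G 1 + δ) / (4 * T) := by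
      have h2 : ∀ᶠ s in nhdsWithin (1:ℝ) (Iio 1), a < s :=
        (eventually_gt_nhds ha).filter_mono nhdsWithin_le_nhds
      have h3 : ∀ᶠ s in nhdsWithin (1:ℝ) (Iio 1), 0 < s :=
        (eventually_gt_nhds zero_lt_one).filter_mono nhdsWithin_le_nhds
      filter_upwards [h2, h3, hyt.eventually hle, hyt.eventually hψo, self_mem_nhdsWithin]
        with T hTa hT0 hTle hTo hT1
      have hT1 : T < 1 := hT1
      have hTm : T ∈ Icc (0:ℝ) 1 := ⟨hT0.le, hT1.le⟩
      have hval := value_le hT0 (control_restrict hT1.le hu) (traj_restrict hT1.le hy) hy0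
      have hsp := intervalIntegral.integral_add_adjacent_intervals
        (ii_sub hint2 le_rfl hT0.le hT1.le) (ii_sub hint2 hT0.le hT1.le le_rfl)
      rw [← heq] at hsp
      have hnorm : ‖y T - x₀‖ ≤ C * (1 - T) := by
        rw [norm_sub_rev, hdiff T hTm]
        have := intervalIntegral.norm_integral_le_of_norm_le_const (a := T) (b := 1) (C := C)
          (f := fun s => ∑ i, u s i • f i (y s)) (fun s hs => by
            rw [uIoc_of_le hT1.le] at hs
            exact hC s ⟨hT0.le.trans hs.1.le, hs.2⟩)
        rwa [abs_of_pos (by linarith)] at this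
      have herr : δ / C * ‖y T - x₀‖ ≤ δ * (1 - T) := by
        calc δ / C * ‖y T - x₀‖ ≤ δ / C * (C * (1 - T)) :=
              mul_le_mul_of_nonneg_left hnorm (by positivity)
          _ = δ * (1 - T) := by field_simp
      have hin : ⟪p, x₀ - y T⟫ = ∫ s in T..1, ⟪p, ∑ i, u s i • f i (y s)⟫ := by
        rw [hdiff T hTm]
        exact ((innerSL ℝ p).intervalIntegral_comp_comm
          (ii_sub hint hT0.le hT1.le le_rfl)).symm
      have hI : ⟪p, x₀ - y T⟫ ≤ T * (∫ s in T..1, ∑ i, (u s i) ^ 2)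
          + (1 - T) * ((G 1 + δ) / (4 * T)) := by
        have e : T * (∫ s in T..1, ∑ i, (u s i) ^ 2) + (1 - T) * ((G 1 + δ) / (4 * T))
            = ∫ s in T..1, (T * (∑ i, (u s i) ^ 2) + (G 1 + δ) / (4 * T)) := by
          rw [intervalIntegral.integral_add
            ((ii_sub hint2 hT0.le hT1.le le_rfl).const_mul T) (by simp),
            intervalIntegral.integral_const_mul, intervalIntegral.integral_const, smul_eq_mul]
        rw [e, hin]
        refine intervalIntegral.integral_mono_on hT1.le ?_ ?_ ?_
        · have hh := ii_sub hint hT0.le hT1.le le_rfl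
          exact ⟨(innerSL ℝ p).integrable_comp hh.1, (innerSL ℝ p).integrable_comp hh.2⟩
        · exact ((ii_sub hint2 hT0.le hT1.le le_rfl).const_mul T).add (by simp)
        · intro s hs
          have hG1 : G s ≤ G 1 + δ := by
            exact hGa s (lt_of_lt_of_le hTa hs.1) ⟨hT0.le.trans hs.1, hs.2⟩
          have h5 : ⟪p, ∑ i, u s i • f i (y s)⟫ ≤ T * (∑ i, (u s i) ^ 2) + G s / (4 * T) := by
            rw [inner_sum, Finset.mul_sum, hG, Finset.sum_div, ← Finset.sum_add_distrib]
            refine Finset.sum_le_sum fun i _ => ?_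
            rw [real_inner_smul_right]
            set g := ⟪p, f i (y s)⟫
            have : T * u s i ^ 2 + g ^ 2 / (4 * T) - u s i * g
                = (2 * T * u s i - g) ^ 2 / (4 * T) := by
              field_simp
              ring
            have h6 : 0 ≤ (2 * T * u s i - g) ^ 2 / (4 * T) := by positivity
            linarith
          have h7 : G s / (4 * T) ≤ (G 1 + δ) / (4 * T) :=
            div_le_div_of_nonneg_right hG1 (by positivity)
          linarith
      have habs := (abs_le.1 (hTo.trans herr)).1
      have hneg : ⟪p, y T - x₀⟫ = -⟪p, x₀ - y T⟫ := by
        rw [← inner_neg_right, neg_sub]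
      rw [hneg] at habs
      set A := ∫ t in (0:ℝ)..T, ∑ i, (u t i) ^ 2
      set B := ∫ t in T..(1:ℝ), ∑ i, (u t i) ^ 2
      set D := (G 1 + δ) / (4 * T)
      have h8 : (1 - T) * ψ x₀ ≤ (1 - T) * (δ + D) := by
        have : T * A = T * ψ x₀ - T * B := by rw [← hsp]; ring
        linarith
      exact le_of_mul_le_mul_left h8 (by linarith)
    have hlim : Tendsto (fun T : ℝ => δ + (G 1 + δ) / (4 * T)) (nhdsWithin 1 (Iio 1))
        (nhds (δ + (G 1 + δ) / (4 * 1))) := by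
      refine Tendsto.mono_left ?_ nhdsWithin_le_nhds
      have : ContinuousAt (fun T : ℝ => δ + (G 1 + δ) / (4 * T)) 1 := by
        refine continuousAt_const.add (continuousAt_const.div (by fun_prop) (by norm_num))
      exact this
    have := ge_of_tendsto hlim hev
    simpa using this
  have hG1 : G 1 = ∑ i, ⟪p, f i x₀⟫ ^ 2 := by simp only [hG, hy1]
  rw [← hG1]
  refine le_of_forall_pos_le_add fun δ hδ => ?_
  have := main (δ / 2) (by linarith)
  linarith

/-- if the value function `V` is finite everywhere, continuous, and its defining
infimum is attained for every `x ≠ x̄`, then `V` is a viscosity solution on `ℝⁿ \ {x̄}` of the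
Hamilton–Jacobi equation `-(1/2)V(x) + H(x, (1/2)dV(x)) = 0`. -/
theorem stmt_10 {n m : ℕ} (f : Fin m → E n → E n) (hf : ∀ i, ContDiff ℝ (⊤ : ℕ∞) (f i))
    (xbar : E n)
    (hfin : ∀ x : E n, valueFun f xbar x ≠ ⊤)
    (hcont : Continuous (fun x => (valueFun f xbar x).toReal))
    (hatt : ∀ x : E n, x ≠ xbar → ∃ u : ℝ → Fin m → ℝ, IsBoundedControl 1 u ∧
      ∃ y : ℝ → E n, IsTrajectoryOn f u 1 y ∧ y 0 = xbar ∧ y 1 = x ∧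
        ENNReal.ofReal (∫ t in (0:ℝ)..1, ∑ i, (u t i) ^ 2) = valueFun f xbar x) :
    ViscositySubsolutionOn {xbar}ᶜ
        (fun x ζ r => -(1 / 2) * r + Ham f x ((1 / 2 : ℝ) • ζ))
        (fun x => (valueFun f xbar x).toReal) ∧
      ViscositySupersolutionOn {xbar}ᶜ
        (fun x ζ r => -(1 / 2) * r + Ham f x ((1 / 2 : ℝ) • ζ))
        (fun x => (valueFun f xbar x).toReal) := by
  have hgrad : ∀ φ : E n → ℝ, ContDiffOn ℝ 1 φ {xbar}ᶜ → ∀ x₀ ∈ ({xbar}ᶜ : Set (E n)),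
      HasGradientAt φ (∇ φ x₀) x₀ := fun φ hφ x₀ hx₀ =>
    ((hφ.contDiffAt (isOpen_compl_singleton.mem_nhds hx₀)).differentiableAt
      (by norm_num)).hasGradientAt
  constructor
  · intro φ hφ hle x₀ hx₀ heq
    have h := sub_part hf hfin (hgrad φ hφ x₀ hx₀)
      (by filter_upwards [isOpen_compl_singleton.mem_nhds hx₀] with x hx using hle x hx) heq
    simp only [ham_half]
    simp only at heq
    rw [← heq]
    linarith
  · intro ψ hψ hle x₀ hx₀ heq
    obtain ⟨u, hu, y, hy, hy0, hy1, hc⟩ := hatt x₀ hx₀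
    have hc' : ψ x₀ = ∫ t in (0:ℝ)..1, ∑ i, (u t i) ^ 2 := by
      rw [heq]
      simp only
      rw [← hc, ENNReal.toReal_ofReal]
      exact intervalIntegral.integral_nonneg zero_le_one fun t _ =>
        Finset.sum_nonneg fun i _ => sq_nonneg _
    have h := super_part (fun i => (hf i).continuous) (hgrad ψ hψ x₀ hx₀)
      (by filter_upwards [isOpen_compl_singleton.mem_nhds hx₀] with x hx using hle x hx)
      hu hy hy0 hy1 hc'
    simp only [ham_half]
    simp only at heq
    rw [← heq]
    linarith
end
end

section
/- Fix smooth vector fields f₁, …, f_m : ℝⁿ → ℝⁿ, an open set V ⊆ ℝⁿ, a C¹ function S : V → ℝ, and c ∈ ℝ such that (1/2)·Σᵢ ⟨∇S(x), fᵢ(x)⟩² = c for every x ∈ V. Let ε > 0, let u : [0, ε] → ℝᵐ be a bounded measurable control, and let y : [0, ε] → V be a trajectory of u contained in V. Then S(y(ε)) − S(y(0)) ≤ ε·c + (1/2)·∫₀^ε Σᵢ uᵢ(t)² dt. -/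
open scoped RealInnerProductSpace ENNReal Gradient
open Set Filter

noncomputable section

/-- if `S` is `C¹` on the open set `V` with
`(1/2) Σᵢ ⟪∇S(x), fᵢ(x)⟫² = c` on `V`, and `y` is a trajectory of a bounded measurable
control `u` on `[0, ε]` contained in `V`, then
`S(y(ε)) - S(y(0)) ≤ ε c + (1/2) ∫₀^ε Σᵢ uᵢ(t)² dt`. -/
theorem stmt_12 {n m : ℕ} (f : Fin m → E n → E n) (hf : ∀ i, ContDiff ℝ (⊤ : ℕ∞) (f i))
    (V : Set (E n)) (hV : IsOpen V) (S : E n → ℝ) (hS : ContDiffOn ℝ 1 S V) (c : ℝ)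
    (hHJ : ∀ x ∈ V, (1 / 2) * ∑ i, ⟪∇ S x, f i x⟫ ^ 2 = c)
    (ε : ℝ) (hε : 0 < ε) (u : ℝ → Fin m → ℝ) (hu : IsBoundedControl ε u)
    (y : ℝ → E n) (hy : IsTrajectoryOn f u ε y) (hyV : ∀ t ∈ Icc (0:ℝ) ε, y t ∈ V) :
    S (y ε) - S (y 0) ≤ ε * c + (1 / 2) * ∫ t in (0:ℝ)..ε, ∑ i, (u t i) ^ 2 := by
  classical
  obtain ⟨hum, K, hK⟩ := hu
  obtain ⟨hyc, hyi⟩ := hy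
  have h0 : (0:ℝ) ∈ Icc (0:ℝ) ε := ⟨le_rfl, hε.le⟩
  have hI : uIcc (0:ℝ) ε = Icc 0 ε := uIcc_of_le hε.le
  have hK0 : 0 ≤ K := (norm_nonneg _).trans (hK 0 h0)
  have hui : ∀ i, ∀ t ∈ Icc (0:ℝ) ε, ‖u t i‖ ≤ K := fun i t ht =>
    (norm_le_pi_norm (u t) i).trans (hK t ht)
  have humi : ∀ i, Measurable fun t => u t i := fun i => (measurable_pi_apply i).comp hum
  -- interval integrability of bounded measurable functions
  have hbdd : ∀ (h : ℝ → ℝ) (C : ℝ), Measurable h → (∀ t ∈ Icc (0:ℝ) ε, ‖h t‖ ≤ C) →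
      IntervalIntegrable h MeasureTheory.volume 0 ε := by
    intro h C hm hb
    rw [intervalIntegrable_iff_integrableOn_Icc_of_le hε.le]
    refine MeasureTheory.Measure.integrableOn_of_bounded (M := C) (by simp)
      hm.aestronglyMeasurable ?_
    filter_upwards [MeasureTheory.ae_restrict_mem measurableSet_Icc] with t ht using hb t ht
  have hfc : ∀ i, ContinuousOn (fun t => f i (y t)) (Icc 0 ε) := fun i =>
    (hf i).continuous.comp_continuousOn hyc
  have hgint : IntervalIntegrable (fun s => ∑ i, u s i • f i (y s))
      MeasureTheory.volume 0 ε := by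
    have := IntervalIntegrable.sum (μ := MeasureTheory.volume) (a := 0) (b := ε)
      (f := fun i s => u s i • f i (y s)) Finset.univ (fun i _ =>
        (hbdd _ K (humi i) (hui i)).smul_continuousOn (by rw [hI]; exact hfc i))
    refine this.congr ?_
    intro s _
    simp
  have hM : ∃ M : ℝ, ∀ t ∈ Icc (0:ℝ) ε, ‖∑ i, u t i • f i (y t)‖ ≤ M := by
    have := fun i => isCompact_Icc.exists_bound_of_continuousOn (hfc i)
    choose B hB using this
    refine ⟨∑ i, K * B i, fun t ht => ?_⟩
    refine (norm_sum_le _ _).trans (Finset.sum_le_sum fun i _ => ?_)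
    rw [norm_smul]
    exact mul_le_mul (hui i t ht) (hB i t ht) (norm_nonneg _) hK0
  obtain ⟨M, hM⟩ := hM
  have hM0 : 0 ≤ M := (norm_nonneg _).trans (hM 0 h0)
  have hyL : LipschitzOnWith M.toNNReal y (Icc 0 ε) := by
    refine LipschitzOnWith.of_dist_le_mul fun a ha b hb => ?_
    have hab : y a - y b = ∫ s in b..a, ∑ i, u s i • f i (y s) := by
      rw [hyi a ha, hyi b hb, add_sub_add_left_eq_sub]
      refine intervalIntegral.integral_interval_sub_left (hgint.mono_set ?_) (hgint.mono_set ?_)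
      · rw [hI]; exact uIcc_subset_Icc h0 ha
      · rw [hI]; exact uIcc_subset_Icc h0 hb
    rw [dist_eq_norm, hab, Real.dist_eq, Real.coe_toNNReal _ hM0]
    refine intervalIntegral.norm_integral_le_of_norm_le_const fun s hs => hM s ?_
    exact uIcc_subset_Icc hb ha (uIoc_subset_uIcc hs)
  have hSat : ∀ x ∈ V, ContDiffAt ℝ 1 S x := fun x hx => hS.contDiffAt (hV.mem_nhds hx)
  have hSL : LocallyLipschitzOn (Set.image y (Icc 0 ε)) S := by
    rintro x ⟨t, ht, rfl⟩
    obtain ⟨L, s, hs, hL⟩ := (hSat _ (hyV t ht)).exists_lipschitzOnWith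
    exact ⟨L, s, mem_nhdsWithin_of_mem_nhds hs, hL⟩
  obtain ⟨L, hL⟩ := hSL.exists_lipschitzOnWith_of_compact (isCompact_Icc.image_of_continuousOn hyc)
  have hSyL : LipschitzOnWith (L * M.toNNReal) (S ∘ y) (uIcc 0 ε) := by
    rw [hI]; exact hL.comp hyL (mapsTo_image _ _)
  have hac := hSyL.absolutelyContinuousOnInterval
  have huu : IntervalIntegrable (fun t => ∑ i, (u t i) ^ 2) MeasureTheory.volume 0 ε := by
    refine hbdd _ (∑ _i : Fin m, K ^ 2)
      (Finset.measurable_sum _ fun i _ => (humi i).pow_const 2) fun t ht => ?_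
    refine (norm_sum_le _ _).trans (Finset.sum_le_sum fun i _ => ?_)
    rw [norm_pow]
    exact pow_le_pow_left₀ (norm_nonneg _) (hui i t ht) 2
  have hkey : (S ∘ y) ε - (S ∘ y) 0 ≤ ∫ t in (0:ℝ)..ε, (c + (1 / 2) * ∑ i, (u t i) ^ 2) := by
    rw [← hac.integral_deriv_eq_sub]
    refine intervalIntegral.integral_mono_ae_restrict hε.le hac.intervalIntegrable_deriv
      (intervalIntegrable_const.add (huu.const_mul _)) ?_
    have h₁ : ∀ᵐ x : ℝ, x ≠ 0 := by simp [MeasureTheory.ae_iff]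
    have h₂ : ∀ᵐ x : ℝ, x ≠ ε := by simp [MeasureTheory.ae_iff]
    rw [Filter.EventuallyLE, MeasureTheory.ae_restrict_iff' measurableSet_Icc]
    filter_upwards [hgint.ae_hasDerivAt_integral, h₁, h₂] with t ht ht0 ht1 htI
    have hd := ht (hI ▸ htI) 0 (hI ▸ h0)
    have hnear : Icc 0 ε ∈ nhds t :=
      Icc_mem_nhds (lt_of_le_of_ne htI.1 ht0.symm) (lt_of_le_of_ne htI.2 ht1)
    have hyd : HasDerivAt y (∑ i, u t i • f i (y t)) t := by
      refine (hd.const_add (y 0)).congr_of_eventuallyEq ?_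
      filter_upwards [hnear] with s hs using hyi s hs
    have hSd : HasFDerivAt S (fderiv ℝ S (y t)) (y t) :=
      ((hSat _ (hyV t htI)).differentiableAt one_ne_zero).hasFDerivAt
    rw [(hSd.comp_hasDerivAt t hyd).deriv, ← toDual_gradient, InnerProductSpace.toDual_apply_apply,
      inner_sum, ← hHJ _ (hyV t htI), ← mul_add, ← Finset.sum_add_distrib, Finset.mul_sum]
    refine Finset.sum_le_sum fun i _ => ?_
    rw [inner_smul_right]
    nlinarith [sq_nonneg (⟪∇ S (y t), f i (y t)⟫ - u t i)]
  rw [intervalIntegral.integral_add intervalIntegrable_const (huu.const_mul _),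
    intervalIntegral.integral_const, intervalIntegral.integral_const_mul] at hkey
  simpa using hkey
end
end

section
/- Fix smooth vector fields f₁, …, f_m : ℝⁿ → ℝⁿ and x̄ ∈ ℝⁿ, and let V be the associated value function. Let u : [0,1] → ℝᵐ be a bounded measurable control with trajectory γ : [0,1] → ℝⁿ, γ(0) = x̄, which is minimizing, i.e., V(γ(1)) = ∫₀¹ Σᵢ uᵢ(s)² ds < ∞. Then for every t ∈ (0,1), V(γ(t)) = t·∫₀^t Σᵢ uᵢ(s)² ds; equivalently, V(γ(1)) = (1/t)·V(γ(t)) + ∫_t^1 Σᵢ uᵢ(s)² ds. -/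
open scoped RealInnerProductSpace ENNReal Gradient
open Set Filter

noncomputable section

open MeasureTheory in
theorem ctrl_sq_integrable {m : ℕ} {u : ℝ → Fin m → ℝ} (hu : IsBoundedControl 1 u)
    {a b : ℝ} (ha : a ∈ Icc (0:ℝ) 1) (hb : b ∈ Icc (0:ℝ) 1) :
    IntervalIntegrable (fun s => ∑ i, (u s i) ^ 2) volume a b := by
  obtain ⟨hm, K, hK⟩ := hu
  rw [intervalIntegrable_iff]
  have hmeas : Measurable (fun s => ∑ i, (u s i) ^ 2) := by
    refine Finset.measurable_sum _ (fun i _ => ?_)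
    exact (((measurable_pi_apply i).comp hm).pow_const 2)
  refine Measure.integrableOn_of_bounded (M := ∑ _i : Fin m, K ^ 2) ?_
    hmeas.aestronglyMeasurable ?_
  · simp [uIoc]
  · refine (ae_restrict_mem measurableSet_uIoc).mono (fun s hs => ?_)
    have hs' : s ∈ Icc (0:ℝ) 1 := uIcc_subset_Icc ha hb (uIoc_subset_uIcc hs)
    have := hK s hs'
    rw [Real.norm_of_nonneg (Finset.sum_nonneg (fun i _ => sq_nonneg _))]
    refine Finset.sum_le_sum (fun i _ => ?_)
    have h1 : |u s i| ≤ K := (norm_le_pi_norm (u s) i).trans this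
    exact sq_le_sq' (by linarith [neg_le_of_abs_le h1]) (le_of_abs_le h1)

open MeasureTheory in
theorem ctrl_zero_adm {n m : ℕ} (f : Fin m → E n → E n) (xbar : E n) :
    IsBoundedControl 1 (fun _ => (0 : Fin m → ℝ)) ∧
    IsTrajectoryOn f (fun _ => (0 : Fin m → ℝ)) 1 (fun _ => xbar) := by
  refine ⟨⟨measurable_const, 0, by simp⟩, continuousOn_const, by simp⟩

theorem valueFun_self {n m : ℕ} (f : Fin m → E n → E n) (xbar : E n) :
    valueFun f xbar xbar = 0 := by
  refine le_antisymm (sInf_le ?_) bot_le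
  exact ⟨_, (ctrl_zero_adm f xbar).1, _, (ctrl_zero_adm f xbar).2, rfl, rfl, by simp⟩

open MeasureTheory in
theorem minimizer_integrable {n m : ℕ} (f : Fin m → E n → E n) (xbar : E n)
    (u : ℝ → Fin m → ℝ) (hu : IsBoundedControl 1 u)
    (γ : ℝ → E n) (hγ : IsTrajectoryOn f u 1 γ) (h0 : γ 0 = xbar)
    (hmin : valueFun f xbar (γ 1) =
      ENNReal.ofReal (∫ s in (0:ℝ)..1, ∑ i, (u s i) ^ 2)) :
    IntervalIntegrable (fun s => ∑ i, u s i • f i (γ s)) volume 0 1 := by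
  by_contra hn
  have h1 := hγ.2 1 (by simp)
  rw [intervalIntegral.integral_undef hn, add_zero, h0] at h1
  rw [h1, valueFun_self, eq_comm, ENNReal.ofReal_eq_zero] at hmin
  have hI := ctrl_sq_integrable hu (a := 0) (b := 1) (by simp) (by simp)
  have hnn : ∀ s, 0 ≤ ∑ i, (u s i) ^ 2 := fun s => Finset.sum_nonneg (fun i _ => sq_nonneg _)
  have hz : ∫ s in (0:ℝ)..1, ∑ i, (u s i) ^ 2 = 0 :=
    le_antisymm hmin (intervalIntegral.integral_nonneg zero_le_one (fun s _ => hnn s))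
  rw [intervalIntegral.integral_eq_zero_iff_of_le_of_nonneg_ae zero_le_one
    (Eventually.of_forall hnn) hI] at hz
  apply hn
  rw [intervalIntegrable_iff_integrableOn_Ioc_of_le zero_le_one]
  refine (integrable_zero ℝ (E n) _).congr ?_
  filter_upwards [hz] with s hs
  have hs' : ∑ i, (u s i) ^ 2 = 0 := hs
  rw [Finset.sum_eq_zero_iff_of_nonneg (fun i _ => sq_nonneg _)] at hs'
  symm
  refine Finset.sum_eq_zero (fun i hi => ?_)
  rw [pow_eq_zero_iff two_ne_zero |>.1 (hs' i hi), zero_smul]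

open MeasureTheory in
theorem exists_integrable_adm {n m : ℕ} (f : Fin m → E n → E n) 
    (w : ℝ → Fin m → ℝ) (hw : IsBoundedControl 1 w)
    (z : ℝ → E n) (hz : IsTrajectoryOn f w 1 z) :
    ∃ w' z', IsBoundedControl 1 w' ∧ IsTrajectoryOn f w' 1 z' ∧ z' 0 = z 0 ∧ z' 1 = z 1 ∧
      IntervalIntegrable (fun s => ∑ i, w' s i • f i (z' s)) volume 0 1 ∧
      (∫ s in (0:ℝ)..1, ∑ i, (w' s i) ^ 2) ≤ ∫ s in (0:ℝ)..1, ∑ i, (w s i) ^ 2 := by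
  by_cases h : IntervalIntegrable (fun s => ∑ i, w s i • f i (z s)) volume 0 1
  · exact ⟨w, z, hw, hz, rfl, rfl, h, le_rfl⟩
  · have h1 := hz.2 1 (by simp)
    rw [intervalIntegral.integral_undef h, add_zero] at h1
    refine ⟨_, _, (ctrl_zero_adm f (z 0)).1, (ctrl_zero_adm f (z 0)).2, rfl, h1.symm, by simp, ?_⟩
    simpa using intervalIntegral.integral_nonneg zero_le_one
      (fun s _ => Finset.sum_nonneg (fun i _ => sq_nonneg (w s i)))

open MeasureTheory in
theorem concat_le {n m : ℕ} (f : Fin m → E n → E n) (xbar : E n)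
    (u : ℝ → Fin m → ℝ) (hu : IsBoundedControl 1 u)
    (γ : ℝ → E n) (hγ : IsTrajectoryOn f u 1 γ)
    (hI : IntervalIntegrable (fun s => ∑ i, u s i • f i (γ s)) volume 0 1)
    (w : ℝ → Fin m → ℝ) (hw : IsBoundedControl 1 w)
    (z : ℝ → E n) (hz : IsTrajectoryOn f w 1 z) (hz0 : z 0 = xbar)
    (hJ : IntervalIntegrable (fun s => ∑ i, w s i • f i (z s)) volume 0 1)
    (t : ℝ) (ht : t ∈ Ioo (0:ℝ) 1) (hz1 : z 1 = γ t) :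
    valueFun f xbar (γ 1) ≤ ENNReal.ofReal (t⁻¹ * (∫ s in (0:ℝ)..1, ∑ i, (w s i) ^ 2)
      + ∫ s in t..1, ∑ i, (u s i) ^ 2) := by
  obtain ⟨ht0, ht1⟩ := ht
  have htn : t ≠ 0 := ht0.ne'
  have hdiv : ∀ s ∈ Icc (0:ℝ) t, s / t ∈ Icc (0:ℝ) 1 := fun s hs =>
    ⟨div_nonneg hs.1 ht0.le, (div_le_one ht0).2 hs.2⟩
  set v : ℝ → Fin m → ℝ := fun s => if s ≤ t then t⁻¹ • w (s / t) else u s with hv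
  set y : ℝ → E n := fun s => if s ≤ t then z (s / t) else γ s with hy
  have hv1 : ∀ s, s ≤ t → v s = t⁻¹ • w (s / t) := fun s hs => by simp [hv, hs]
  have hv2 : ∀ s, t < s → v s = u s := fun s hs => by simp [hv, not_le.2 hs]
  have hy1 : ∀ s, s ≤ t → y s = z (s / t) := fun s hs => by simp [hy, hs]
  have hy2 : ∀ s, t ≤ s → y s = γ s := fun s hs => by
    rcases hs.eq_or_lt with h | h
    · subst h; rw [hy1 _ le_rfl, div_self htn, hz1]
    · simp [hy, not_le.2 h]
  have hvb : IsBoundedControl 1 v := by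
    obtain ⟨hum, K, hK⟩ := hu
    obtain ⟨hwm, L, hL⟩ := hw
    refine ⟨Measurable.ite measurableSet_Iic
      ((hwm.comp (measurable_id.div_const t)).const_smul t⁻¹) hum, max (t⁻¹ * L) K, ?_⟩
    intro s hs
    rcases le_or_gt s t with h | h
    · rw [hv1 s h, norm_smul, Real.norm_of_nonneg (inv_nonneg.2 ht0.le)]
      exact le_max_of_le_left (mul_le_mul_of_nonneg_left (hL _ (hdiv s ⟨hs.1, h⟩))
        (inv_nonneg.2 ht0.le))
    · rw [hv2 s h]
      exact le_max_of_le_right (hK s hs)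
  have hG1 : ∀ s, s ≤ t → ∑ i, v s i • f i (y s) = 
      t⁻¹ • ∑ i, w (s / t) i • f i (z (s / t)) := by
    intro s hs
    rw [hv1 s hs, hy1 s hs, Finset.smul_sum]
    simp [smul_smul]
  have hG2 : ∀ s, t < s → ∑ i, v s i • f i (y s) = ∑ i, u s i • f i (γ s) := by
    intro s hs
    rw [hv2 s hs, hy2 s hs.le]
  have hA : ∀ s ∈ Icc 0 t, ∫ r in (0:ℝ)..s, ∑ i, v r i • f i (y r) = z (s / t) - z 0 := by
    intro s hs
    have e1 : ∫ r in (0:ℝ)..s, ∑ i, v r i • f i (y r) =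
        ∫ r in (0:ℝ)..s, t⁻¹ • ∑ i, w (r / t) i • f i (z (r / t)) := by
      refine intervalIntegral.integral_congr (fun r hr => ?_)
      rw [uIcc_of_le hs.1] at hr
      exact hG1 r (hr.2.trans hs.2)
    have e2 := intervalIntegral.inv_smul_integral_comp_div (a := 0) (b := s)
      (fun r => ∑ i, w r i • f i (z r)) t
    rw [e1, intervalIntegral.integral_smul, e2, zero_div, hz.2 _ (hdiv s hs), add_sub_cancel_left]
  have hIa : IntervalIntegrable (fun r => ∑ i, v r i • f i (y r)) volume 0 t := by
    have := (hJ.comp_mul_right (c := t⁻¹)).smul (t⁻¹)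
    simp only [zero_div, one_div, inv_inv, ← div_eq_mul_inv] at this
    refine this.congr ?_
    intro r hr
    rw [uIoc_of_le ht0.le] at hr
    exact (hG1 r hr.2).symm
  have hI2 : ∀ s ∈ Icc t 1, IntervalIntegrable (fun r => ∑ i, u r i • f i (γ r)) volume t s := by
    intro s hs
    refine hI.mono_set ?_
    rw [uIcc_of_le hs.1, uIcc_of_le zero_le_one]
    exact Icc_subset_Icc ht0.le hs.2
  have hI1 : IntervalIntegrable (fun r => ∑ i, u r i • f i (γ r)) volume 0 t := by
    refine hI.mono_set ?_
    rw [uIcc_of_le ht0.le, uIcc_of_le zero_le_one]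
    exact Icc_subset_Icc le_rfl ht1.le
  have hB : ∀ s ∈ Icc t 1, ∫ r in (0:ℝ)..s, ∑ i, v r i • f i (y r) = γ s - z 0 := by
    intro s hs
    have hc : EqOn (fun r => ∑ i, u r i • f i (γ r)) (fun r => ∑ i, v r i • f i (y r))
        (uIoc t s) := by
      intro r hr
      rw [uIoc_of_le hs.1] at hr
      exact (hG2 r hr.1).symm
    rw [← intervalIntegral.integral_add_adjacent_intervals hIa ((hI2 s hs).congr hc),
      hA t ⟨ht0.le, le_rfl⟩, div_self htn, hz1,
      ← intervalIntegral.integral_congr_ae (Eventually.of_forall hc),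
      ← intervalIntegral.integral_interval_sub_left (hI1.trans (hI2 s hs)) hI1]
    have q1 := hγ.2 s ⟨ht0.le.trans hs.1, hs.2⟩
    have q2 := hγ.2 t ⟨ht0.le, ht1.le⟩
    rw [q1, q2]
    abel
  have hy0 : y 0 = z 0 := by rw [hy1 0 ht0.le, zero_div]
  refine sInf_le ⟨v, hvb, y, ⟨?_, ?_⟩, hy0.trans hz0, hy2 1 ht1.le, ?_⟩
  · rw [← Icc_union_Icc_eq_Icc ht0.le ht1.le]
    refine ContinuousOn.union_of_isClosed ?_ ?_ isClosed_Icc isClosed_Icc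
    · exact (hz.1.comp (continuous_id.div_const t).continuousOn hdiv).congr
        (fun s hs => hy1 s hs.2)
    · exact (hγ.1.mono (Icc_subset_Icc ht0.le le_rfl)).congr (fun s hs => hy2 s hs.1)
  · intro s hs
    rcases le_total s t with h | h
    · rw [hA s ⟨hs.1, h⟩, hy0, hy1 s h]; abel
    · rw [hB s ⟨h, hs.2⟩, hy0, hy2 s h]; abel
  · congr 1
    have c0 : (0:ℝ) ∈ Icc (0:ℝ) 1 := by simp
    have c1 : (1:ℝ) ∈ Icc (0:ℝ) 1 := by simp
    have ct : t ∈ Icc (0:ℝ) 1 := ⟨ht0.le, ht1.le⟩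
    rw [← intervalIntegral.integral_add_adjacent_intervals
      (ctrl_sq_integrable hvb c0 ct) (ctrl_sq_integrable hvb ct c1)]
    congr 1
    · have e1 : ∫ r in (0:ℝ)..t, ∑ i, (v r i) ^ 2 =
        ∫ r in (0:ℝ)..t, t⁻¹ * (t⁻¹ * ∑ i, (w (r / t) i) ^ 2) := by
        refine intervalIntegral.integral_congr (fun r hr => ?_)
        rw [uIcc_of_le ht0.le] at hr
        simp only [hv1 r hr.2, Pi.smul_apply, smul_eq_mul, mul_pow, ← Finset.mul_sum]
        ring
      have e2 := intervalIntegral.inv_smul_integral_comp_div (a := 0) (b := t)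
        (fun r => ∑ i, (w r i) ^ 2) t
      rw [zero_div, div_self htn, smul_eq_mul] at e2
      rw [e1, intervalIntegral.integral_const_mul, intervalIntegral.integral_const_mul, e2]
    · refine intervalIntegral.integral_congr_ae (Eventually.of_forall fun r hr => ?_)
      rw [uIoc_of_le ht1.le] at hr
      simp only [hv2 r hr.1]

open MeasureTheory in
theorem restrict_le {n m : ℕ} (f : Fin m → E n → E n) (xbar : E n)
    (u : ℝ → Fin m → ℝ) (hu : IsBoundedControl 1 u)
    (γ : ℝ → E n) (hγ : IsTrajectoryOn f u 1 γ) (h0 : γ 0 = xbar)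
    (t : ℝ) (ht : t ∈ Ioo (0:ℝ) 1) :
    valueFun f xbar (γ t) ≤
      ENNReal.ofReal (t * ∫ s in (0:ℝ)..t, ∑ i, (u s i) ^ 2) := by
  obtain ⟨ht0, ht1⟩ := ht
  have hmul : ∀ s ∈ Icc (0:ℝ) 1, t * s ∈ Icc (0:ℝ) 1 := fun s hs =>
    ⟨mul_nonneg ht0.le hs.1, mul_le_one₀ ht1.le hs.1 hs.2⟩
  refine sInf_le ⟨fun s => t • u (t * s), ⟨?_, ?_⟩, fun s => γ (t * s), ⟨?_, ?_⟩, ?_, ?_, ?_⟩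
  · exact (hu.1.comp (measurable_const_mul t)).const_smul t
  · obtain ⟨-, K, hK⟩ := hu
    refine ⟨t * K, fun s hs => ?_⟩
    rw [norm_smul, Real.norm_of_nonneg ht0.le]
    exact mul_le_mul_of_nonneg_left (hK _ (hmul s hs)) ht0.le
  · exact hγ.1.comp (continuous_const_mul t).continuousOn hmul
  · intro s hs
    have e2 := intervalIntegral.smul_integral_comp_mul_left (a := 0) (b := s)
      (fun r => ∑ i, u r i • f i (γ r)) t
    rw [mul_zero] at e2
    have e3 := hγ.2 _ (hmul s hs)
    rw [← e2, ← intervalIntegral.integral_smul] at e3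
    simp only [mul_zero]
    rw [e3]
    simp only [Finset.smul_sum, smul_smul, Pi.smul_apply, smul_eq_mul]
  · simpa using h0
  · simp
  · congr 1
    have e2 := intervalIntegral.smul_integral_comp_mul_left (a := 0) (b := 1)
      (fun r => ∑ i, (u r i) ^ 2) t
    rw [mul_zero, mul_one, smul_eq_mul] at e2
    rw [← e2, ← intervalIntegral.integral_const_mul, ← intervalIntegral.integral_const_mul]
    refine intervalIntegral.integral_congr (fun r _ => ?_)
    simp only [Pi.smul_apply, smul_eq_mul, mul_pow, ← Finset.mul_sum]
    ring

/-- if `γ` is a minimizing trajectory on `[0,1]` of a bounded measurable control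
`u` with `γ(0) = x̄`, i.e. `V(γ(1)) = ∫₀¹ Σᵢ uᵢ(s)² ds`, then for every `t ∈ (0,1)`,
`V(γ(t)) = t·∫₀^t Σᵢ uᵢ(s)² ds`. -/
theorem stmt_14 {n m : ℕ} (f : Fin m → E n → E n) (xbar : E n)
    (u : ℝ → Fin m → ℝ) (hu : IsBoundedControl 1 u)
    (γ : ℝ → E n) (hγ : IsTrajectoryOn f u 1 γ) (h0 : γ 0 = xbar)
    (hmin : valueFun f xbar (γ 1) =
      ENNReal.ofReal (∫ s in (0:ℝ)..1, ∑ i, (u s i) ^ 2))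
    (t : ℝ) (ht : t ∈ Ioo (0:ℝ) 1) :
    valueFun f xbar (γ t) =
      ENNReal.ofReal (t * ∫ s in (0:ℝ)..t, ∑ i, (u s i) ^ 2) := by
  refine le_antisymm (restrict_le f xbar u hu γ hγ h0 t ht) ?_
  have hI := minimizer_integrable f xbar u hu γ hγ h0 hmin
  refine le_sInf ?_
  rintro c ⟨w₀, hw₀, z₀, hz₀, hz0, hz1, rfl⟩
  obtain ⟨w, z, hw, hz, e0, e1, hJ, hle⟩ := exists_integrable_adm f w₀ hw₀ z₀ hz₀
  refine le_trans ?_ (ENNReal.ofReal_le_ofReal hle)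
  have key := concat_le f xbar u hu γ hγ hI w hw z hz (e0.trans hz0) hJ t ht (e1.trans hz1)
  obtain ⟨ht0, ht1⟩ := ht
  have c0 : (0:ℝ) ∈ Icc (0:ℝ) 1 := by simp
  have c1 : (1:ℝ) ∈ Icc (0:ℝ) 1 := by simp
  have ct : t ∈ Icc (0:ℝ) 1 := ⟨ht0.le, ht1.le⟩
  have p1 : 0 ≤ ∫ s in (0:ℝ)..1, ∑ i, (w s i) ^ 2 :=
    intervalIntegral.integral_nonneg zero_le_one
      (fun s _ => Finset.sum_nonneg (fun i _ => sq_nonneg _))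
  have p2 : 0 ≤ ∫ s in t..1, ∑ i, (u s i) ^ 2 :=
    intervalIntegral.integral_nonneg ht1.le
      (fun s _ => Finset.sum_nonneg (fun i _ => sq_nonneg _))
  rw [hmin, ENNReal.ofReal_le_ofReal_iff
    (add_nonneg (mul_nonneg (inv_nonneg.2 ht0.le) p1) p2),
    ← intervalIntegral.integral_add_adjacent_intervals
      (ctrl_sq_integrable hu c0 ct) (ctrl_sq_integrable hu ct c1)] at key
  apply ENNReal.ofReal_le_ofReal
  have k2 := mul_le_mul_of_nonneg_left (le_of_add_le_add_right key) ht0.le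
  rwa [← mul_assoc, mul_inv_cancel₀ ht0.ne', one_mul] at k2
end
end

section
/- Let U ⊆ ℝⁿ be open and let u : U → ℝ be locally semiconcave on U. Let x ∈ U and let (x_k) be a sequence in U converging to x such that u is differentiable at each x_k and ∇u(x_k) → p for some p ∈ ℝⁿ. Then p ∈ D⁺u(x). -/
open scoped RealInnerProductSpace ENNReal Gradient
open Set Filter

noncomputable section

lemma semiconcave_concave {n : ℕ} {C : ℝ} {V : Set (E n)} {u : E n → ℝ} (hV : Convex ℝ V)
    (h : IsSemiconcaveOn C V u) : ConcaveOn ℝ V (fun y => u y - C * ‖y‖ ^ 2) := by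
  refine ⟨hV, ?_⟩
  intro a ha b hb s t hs ht hst
  obtain rfl : t = 1 - s := by linarith
  have h1 := h a ha b hb s ⟨hs, by linarith⟩
  have h2 : ‖s • a + (1 - s) • b‖ ^ 2
      = s * ‖a‖ ^ 2 + (1 - s) * ‖b‖ ^ 2 - s * (1 - s) * ‖a - b‖ ^ 2 := by
    rw [norm_add_sq_real, norm_sub_sq_real, norm_smul, norm_smul, real_inner_smul_left,
      real_inner_smul_right, mul_pow, mul_pow, Real.norm_eq_abs, Real.norm_eq_abs, sq_abs, sq_abs]
    ring
  simp only [smul_eq_mul]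
  rw [h2]
  linarith

lemma semiconcave_grad {n : ℕ} {C : ℝ} {V : Set (E n)} {u : E n → ℝ}
    (h : IsSemiconcaveOn C V u) {z y : E n} (hz : z ∈ V) (hy : y ∈ V)
    (hd : DifferentiableAt ℝ u z) :
    u y ≤ u z + ⟪∇ u z, y - z⟫ + C * ‖y - z‖ ^ 2 := by
  have hg : HasDerivAt (fun t : ℝ => u (z + t • (y - z))) ⟪∇ u z, y - z⟫ 0 := by
    have h1 : HasDerivAt (fun t : ℝ => z + t • (y - z)) (y - z) 0 := by
      simpa using ((hasDerivAt_id (0:ℝ)).smul_const (y - z)).const_add z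
    have h2 : HasFDerivAt u (InnerProductSpace.toDual ℝ (E n) (∇ u z)) (z + (0:ℝ) • (y - z)) := by
      simpa using hd.hasGradientAt.hasFDerivAt
    simpa [Function.comp_def] using h2.comp_hasDerivAt (0:ℝ) h1
  have hs := hg.tendsto_slope_zero_right
  have hr : Tendsto (fun t : ℝ => u y - u z - (1 - t) * C * ‖y - z‖ ^ 2)
      (nhdsWithin 0 (Ioi 0)) (nhds (u y - u z - (1 - 0) * C * ‖y - z‖ ^ 2)) := by
    apply Tendsto.mono_left _ nhdsWithin_le_nhds
    apply Continuous.tendsto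
    fun_prop
  have := le_of_tendsto_of_tendsto hr hs (by
    filter_upwards [Ioo_mem_nhdsGT (show (0:ℝ) < 1 by norm_num)] with t ht
    have h3 := h y hy z hz t ⟨ht.1.le, ht.2.le⟩
    have h4 : t • y + (1 - t) • z = z + t • (y - z) := by module
    rw [h4] at h3
    simp only [zero_add, zero_smul, add_zero, smul_eq_mul]
    rw [inv_mul_eq_div, le_div_iff₀ ht.1]
    linarith)
  linarith

/-- if `u` is locally semiconcave on the open set `U`, `x ∈ U`, and `(x_k)` is a
sequence of points of `U` converging to `x` at which `u` is differentiable with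
`∇u(x_k) → p`, then `p ∈ D⁺u(x)`. -/
theorem stmt_15 {n : ℕ} (U : Set (E n)) (hU : IsOpen U) (u : E n → ℝ)
    (hu : LocallySemiconcaveOn U u) (x : E n) (hx : x ∈ U) (xk : ℕ → E n)
    (hmem : ∀ k, xk k ∈ U) (hdiff : ∀ k, DifferentiableAt ℝ u (xk k))
    (hlim : Tendsto xk atTop (nhds x)) (p : E n)
    (hgrad : Tendsto (fun k => ∇ u (xk k)) atTop (nhds p)) :
    p ∈ superdiff u x := by
  obtain ⟨V, hVo, hVc, hxV, -, C, hC, hsc⟩ := hu x hx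
  have hcont : ContinuousAt u x := by
    have h1 := ((semiconcave_concave hVc hsc).continuousOn hVo).continuousAt (hVo.mem_nhds hxV)
    have h2 : ContinuousAt (fun y : E n => C * ‖y‖ ^ 2) x := by fun_prop
    refine (h1.add h2).congr (Eventually.of_forall fun y => ?_)
    simp
  have key : ∀ y ∈ V, u y ≤ u x + ⟪p, y - x⟫ + C * ‖y - x‖ ^ 2 := by
    intro y hy
    have hsub : Tendsto (fun k => y - xk k) atTop (nhds (y - x)) := hlim.const_sub y
    have hT : Tendsto (fun k => u (xk k) + ⟪∇ u (xk k), y - xk k⟫ + C * ‖y - xk k‖ ^ 2) atTop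
        (nhds (u x + ⟪p, y - x⟫ + C * ‖y - x‖ ^ 2)) :=
      ((hcont.tendsto.comp hlim).add (hgrad.inner hsub)).add ((hsub.norm.pow 2).const_mul C)
    refine ge_of_tendsto hT ?_
    filter_upwards [hlim.eventually (hVo.mem_nhds hxV)] with k hk
    exact semiconcave_grad hsc hk hy (hdiff k)
  intro ε hε
  have hsm : ∀ᶠ y in nhds x, C * ‖y - x‖ < ε := by
    have : ContinuousAt (fun y : E n => C * ‖y - x‖) x := by fun_prop
    exact this.eventually_lt continuousAt_const (by simpa using hε)
  filter_upwards [hVo.mem_nhds hxV, hsm] with y hy hy2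
  have := key y hy
  have := mul_le_mul_of_nonneg_right hy2.le (norm_nonneg (y - x))
  nlinarith
end
end
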